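/- Let n ≥ 4 and let f be a quadratic form with rational coefficients in n+1 variables of signature (n,1) which represents the form q_3 = -x_0^2 + x_1^2 + x_2^2 + x_3^2. Then the group O(f,ℤ) is noncoherent; that is, O(f,ℤ) contains a finitely generated subgroup which is not finitely presented. -/

import Mathlib

namespace Paper

open Matrix

/-- Value at `x` of the quadratic form with Gram matrix `Q`. -/
def qeval {m : ℕ} {R : Type*} [CommRing R] (Q : Matrix (Fin m) (Fin m) R) (x : Fin m → R) : R :=
  x ⬝ᵥ (Q *ᵥ x)

/-- The polar bilinear form `B(x,y) = (f(x+y) - f(x) - f(y))/2` of the quadratic form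
with Gram matrix `Q`. -/
def qpolar {m : ℕ} {K : Type*} [Field K] (Q : Matrix (Fin m) (Fin m) K) (x y : Fin m → K) : K :=
  (qeval Q (x + y) - qeval Q x - qeval Q y) / 2

/-- A real quadratic form (given by its Gram matrix `Q`) has signature `(r,s)`:
`r + s = m` and it is linearly equivalent over `ℝ` to
`x_1^2 + ... + x_r^2 - x_{r+1}^2 - ... - x_m^2`. -/
def RealSignature {m : ℕ} (Q : Matrix (Fin m) (Fin m) ℝ) (r s : ℕ) : Prop :=
  r + s = m ∧ ∃ T : Matrix (Fin m) (Fin m) ℝ, T.det ≠ 0 ∧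
    ∀ x : Fin m → ℝ, qeval Q (T *ᵥ x) = ∑ i : Fin m, (if (i : ℕ) < r then (x i)^2 else -(x i)^2)

/-- A rational quadratic form has signature `(r,s)` if it does as a real quadratic form. -/
def HasSignature {m : ℕ} (Q : Matrix (Fin m) (Fin m) ℚ) (r s : ℕ) : Prop :=
  RealSignature (Q.map (Rat.cast : ℚ → ℝ)) r s

/-- The rational quadratic form `F` (in `n` variables) represents the rational quadratic
form `G` (in `k` variables): after a linear change of coordinates over `ℚ`,
`F(x_1,...,x_n) = G(x_1,...,x_k) + H(x_{k+1},...,x_n)` for some rational quadratic form `H`. -/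
def Represents {n k : ℕ} (F : Matrix (Fin n) (Fin n) ℚ) (G : Matrix (Fin k) (Fin k) ℚ) : Prop :=
  ∃ (m : ℕ) (hm : n = k + m) (H : Matrix (Fin m) (Fin m) ℚ) (T : Matrix (Fin n) (Fin n) ℚ),
    T.det ≠ 0 ∧ ∀ (x : Fin k → ℚ) (y : Fin m → ℚ),
      qeval F (T *ᵥ (Fin.append x y ∘ Fin.cast hm)) = qeval G x + qeval H y

/-- The group `O(f, A)` of matrices in `GL(m, A)` preserving the quadratic form `f`
(with Gram matrix `Q` over `K ⊇ A`): those `M` with `f(Mx) = f(x)` for all `x`. -/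
def ortho {m : ℕ} (A : Type*) [CommRing A] {K : Type*} [Field K] [Algebra A K]
    (Q : Matrix (Fin m) (Fin m) K) : Subgroup (GL (Fin m) A) where
  carrier := { M | ∀ x : Fin m → K,
      qeval Q (((M : Matrix (Fin m) (Fin m) A).map (algebraMap A K)) *ᵥ x) = qeval Q x }
  one_mem' := by
    intro x
    have h1 : ((1 : GL (Fin m) A) : Matrix (Fin m) (Fin m) A).map (algebraMap A K) = 1 := by
      simp [Matrix.map_one]
    rw [h1, Matrix.one_mulVec]
  mul_mem' := by
    intro a b ha hb x
    have h : ((a * b : GL (Fin m) A) : Matrix (Fin m) (Fin m) A).map (algebraMap A K)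
        = ((a : Matrix (Fin m) (Fin m) A).map (algebraMap A K)) *
          ((b : Matrix (Fin m) (Fin m) A).map (algebraMap A K)) := by
      rw [Units.val_mul, Matrix.map_mul]
    rw [h, ← Matrix.mulVec_mulVec, ha, hb]
  inv_mem' := by
    intro a ha x
    set M := ((a : Matrix (Fin m) (Fin m) A).map (algebraMap A K)) with hM
    set N := (((a⁻¹ : GL (Fin m) A) : Matrix (Fin m) (Fin m) A).map (algebraMap A K)) with hN
    have hMN : M * N = 1 := by
      rw [hM, hN, ← Matrix.map_mul]
      have : (a : Matrix (Fin m) (Fin m) A) * ((a⁻¹ : GL (Fin m) A) : Matrix (Fin m) (Fin m) A)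
          = 1 := a.mul_inv
      rw [this]
      simp [Matrix.map_one]
    have ha' : ∀ y : Fin m → K, qeval Q (M *ᵥ y) = qeval Q y := ha
    calc qeval Q (N *ᵥ x) = qeval Q (M *ᵥ (N *ᵥ x)) := (ha' (N *ᵥ x)).symm
      _ = qeval Q ((M * N) *ᵥ x) := by rw [Matrix.mulVec_mulVec]
      _ = qeval Q x := by rw [hMN, Matrix.one_mulVec]

/-- `O(f, ℤ)` for a rational quadratic form `f` with Gram matrix `Q`. -/
abbrev OZ {m : ℕ} (Q : Matrix (Fin m) (Fin m) ℚ) : Subgroup (GL (Fin m) ℤ) := ortho ℤ Q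

/-- A group is finitely presented: it is a quotient of a finitely generated free group by
the normal closure of a finite set of relators. -/
def IsFinitelyPresented (G : Type*) [Group G] : Prop :=
  ∃ (n : ℕ) (rels : Set (FreeGroup (Fin n))), rels.Finite ∧ Nonempty (PresentedGroup rels ≃* G)

/-- A group is coherent if each of its finitely generated subgroups is finitely presented. -/
def IsCoherent (G : Type*) [Group G] : Prop :=
  ∀ H : Subgroup G, Group.FG H → IsFinitelyPresented H

/-- Two groups are abstractly commensurable if they contain isomorphic
subgroups of finite index. -/
def AbstractlyCommensurable (G H : Type*) [Group G] [Group H] : Prop :=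
  ∃ (G' : Subgroup G) (H' : Subgroup H), G'.FiniteIndex ∧ H'.FiniteIndex ∧ Nonempty (G' ≃* H')

/-- The form `q₃ = -x₀² + x₁² + x₂² + x₃²`. -/
def q3 : Matrix (Fin 4) (Fin 4) ℚ := Matrix.diagonal ![-1, 1, 1, 1]

end Paper

namespace Paper

theorem fp_kernel {P H : Type*} [Group P] [Group H] (hP : Group.FG P) (φ : P →* H)
    (hφ : Function.Surjective φ) (hH : IsFinitelyPresented H) :
    ∃ R : Set P, R.Finite ∧ R ⊆ φ.ker ∧ φ.ker ≤ Subgroup.normalClosure R := by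
  obtain ⟨n, rels, hfin, ⟨e⟩⟩ := hH
  obtain ⟨S, hS⟩ := hP.out
  let g : FreeGroup (Fin n) →* H := e.toMonoidHom.comp (PresentedGroup.mk rels)
  have hg : Function.Surjective g := e.surjective.comp (PresentedGroup.mk_surjective rels)
  have hgker : ∀ u, g u = 1 → u ∈ Subgroup.normalClosure rels := by
    intro u hu
    have : PresentedGroup.mk rels u = 1 := by
      apply e.injective
      rw [map_one]; exact hu
    exact (QuotientGroup.eq_one_iff u).1 this
  choose lf hlf using hφ
  let gt : FreeGroup (Fin n) →* P := FreeGroup.lift (fun i => lf (g (FreeGroup.of i)))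
  have hgt : ∀ u, φ (gt u) = g u := by
    intro u
    have : φ.comp gt = g := by
      ext i
      simp [gt, hlf]
    exact DFunLike.congr_fun this u
  choose wd hwd using hg
  let R : Set P := gt '' rels ∪ (fun p => p⁻¹ * gt (wd (φ p))) '' (S : Set P)
  have hRsub : R ⊆ φ.ker := by
    rintro x (⟨r, hr, rfl⟩ | ⟨p, hp, rfl⟩)
    · rw [SetLike.mem_coe, MonoidHom.mem_ker, hgt]
      have : PresentedGroup.mk rels r = 1 := PresentedGroup.one_of_mem hr
      simp [g, this]
    · rw [SetLike.mem_coe, MonoidHom.mem_ker]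
      simp [hgt, hwd]
  refine ⟨R, (hfin.image _).union (S.finite_toSet.image _), hRsub, ?_⟩
  set N := Subgroup.normalClosure R with hN
  have hsurj : ∀ x : P, ∃ u, (x : P ⧸ N) = ((gt u : P) : P ⧸ N) := by
    intro x
    have hx : x ∈ Subgroup.closure (S : Set P) := by rw [hS]; trivial
    induction hx using Subgroup.closure_induction with
    | mem p hp =>
      refine ⟨wd (φ p), ?_⟩
      rw [QuotientGroup.eq]
      exact Subgroup.subset_normalClosure (Or.inr ⟨p, hp, rfl⟩)
    | one => exact ⟨1, by simp⟩
    | mul a b _ _ ha hb =>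
      obtain ⟨u, hu⟩ := ha
      obtain ⟨v, hv⟩ := hb
      exact ⟨u * v, by rw [map_mul, QuotientGroup.mk_mul, QuotientGroup.mk_mul, hu, hv]⟩
    | inv a _ ha =>
      obtain ⟨u, hu⟩ := ha
      exact ⟨u⁻¹, by rw [map_inv, QuotientGroup.mk_inv, QuotientGroup.mk_inv, hu]⟩
  intro x hx
  obtain ⟨u, hu⟩ := hsurj x
  have h1 : x⁻¹ * gt u ∈ N := QuotientGroup.eq.1 hu
  have hNk : N ≤ φ.ker := Subgroup.normalClosure_le_normal hRsub
  have h2 : φ (gt u) = 1 := by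
    have := hNk h1
    rw [MonoidHom.mem_ker, map_mul, map_inv, MonoidHom.mem_ker.1 hx] at this
    simpa using this
  have h3 : u ∈ Subgroup.normalClosure rels := hgker u (by rw [← hgt, h2])
  have h4 : gt u ∈ N := by
    have : Subgroup.normalClosure rels ≤ N.comap gt :=
      Subgroup.normalClosure_le_normal (fun r hr => Subgroup.subset_normalClosure (Or.inl ⟨r, hr, rfl⟩))
    exact this h3
  have h5 := N.mul_mem h4 (N.inv_mem h1)
  simpa using h5

end Paper

namespace Paper
open Monoid

section amalgam
variable {A : Type*} [Group A]

abbrev Am (C : Subgroup A) : Type _ := PushoutI (fun _ : Bool => C.subtype)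

theorem am_inj {𝒢 X : Type*} [Group 𝒢] [MulAction 𝒢 X] (C : Subgroup A) (f : Bool → (A →* 𝒢))
    (hfinj : ∀ c ∈ C, f true c = 1 → c = 1) (k : C →* 𝒢)
    (hk : ∀ i, (f i).comp C.subtype = k)
    (D : Set X) (Y : Bool → Set X) (hYD : ∀ i, Y i ⊆ D) (hdisj : ∀ i j, i ≠ j → ∀ x, x ∈ Y i → x ∉ Y j)
    (x0 : X) (hx0 : x0 ∈ D) (hx0Y : ∀ i, x0 ∉ Y i) (hfix : ∀ c : C, k c • x0 ∈ D ∧ ∀ i, k c • x0 ∉ Y i)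
    (hpres : ∀ (c : C) i, ∀ y ∈ Y i, k c • y ∈ Y i)
    (hpp : ∀ i a, a ∉ C → ∀ z ∈ D, z ∉ Y i → f i a • z ∈ Y i) :
    Function.Injective (PushoutI.lift (φ := fun _ : Bool => C.subtype) f k hk) := by
  classical
  set Φ := PushoutI.lift (φ := fun _ : Bool => C.subtype) f k hk with hΦ
  rw [injective_iff_map_eq_one]
  intro x hx
  obtain ⟨d⟩ := PushoutI.NormalWord.transversal_nonempty (fun _ : Bool => C.subtype)
    (fun _ => C.subtype_injective)
  have key : ∀ w : PushoutI.NormalWord d, (∀ i, w.fstIdx = some i → Φ w.prod • x0 ∈ Y i) ∧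
      (w.fstIdx = none → ∃ c : C, w.prod = PushoutI.base _ c) := by
    intro w
    induction w using PushoutI.NormalWord.consRecOn with
    | empty =>
      refine ⟨fun i hi => ?_, fun _ => ⟨1, by simp⟩⟩
      simp [PushoutI.NormalWord.empty, CoprodI.Word.fstIdx, CoprodI.Word.empty] at hi
    | cons i g w hmw hgn hgr hw1 ih =>
      have hfst : (PushoutI.NormalWord.cons g w hmw hgr).fstIdx = some i := by
        simp [PushoutI.NormalWord.cons, CoprodI.Word.cons, CoprodI.Word.fstIdx]
      refine ⟨fun j hj => ?_, fun h => by rw [hfst] at h; cases h⟩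
      rw [hfst] at hj
      obtain rfl : i = j := by simpa using hj
      rw [PushoutI.NormalWord.prod_cons, map_mul, mul_smul]
      have hg : g ∉ C := fun hg => hgr ⟨⟨g, hg⟩, rfl⟩
      have e1 : Φ (PushoutI.of i g) = f i g := by simp [hΦ]
      rw [e1]
      cases hw : w.fstIdx with
      | none =>
        obtain ⟨c, hc⟩ := ih.2 hw
        have : Φ w.prod = k c := by
          rw [hc]; simp only [hΦ, PushoutI.lift_base]
        rw [this]
        exact hpp i g hg _ (hfix c).1 ((hfix c).2 i)
      | some j =>
        have h1 := ih.1 j hw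
        have hij : j ≠ i := by rintro rfl; exact hmw hw
        exact hpp i g hg _ (hYD _ h1) (hdisj j i hij _ h1)
    | base h w hw1 ih =>
      have hfst : (PushoutI.base (fun _ : Bool => C.subtype) h • w).fstIdx = w.fstIdx := by
        rw [PushoutI.NormalWord.base_smul_def]
      have hpr : (PushoutI.base (fun _ : Bool => C.subtype) h • w).prod
        = PushoutI.base _ h * w.prod := by
        rw [PushoutI.NormalWord.base_smul_eq_smul, PushoutI.NormalWord.prod_base_smul]
      rw [hfst, hpr]
      refine ⟨fun i hi => ?_, fun hn => ?_⟩
      · rw [map_mul, mul_smul]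
        have : Φ (PushoutI.base _ h) = k h := by simp [hΦ]
        rw [this]
        exact hpres h i _ (ih.1 i hi)
      · obtain ⟨c, hc⟩ := ih.2 hn
        exact ⟨h * c, by rw [hc, map_mul]⟩
  have hw := key (x • PushoutI.NormalWord.empty)
  have hp : (x • (PushoutI.NormalWord.empty : PushoutI.NormalWord d)).prod = x := by
    rw [PushoutI.NormalWord.prod_smul]; simp
  rw [hp, hx] at hw
  cases hi : (x • (PushoutI.NormalWord.empty : PushoutI.NormalWord d)).fstIdx with
  | some i =>
    have := hw.1 i hi
    rw [one_smul] at this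
    exact absurd this (hx0Y i)
  | none =>
    obtain ⟨c, hc⟩ := hw.2 hi
    rw [hc] at hx ⊢
    simp only [hΦ, PushoutI.lift_base] at hx
    have h2 : f true c = 1 := by
      rw [← hx, ← hk true]; rfl
    have := hfinj c c.2 h2
    have : c = 1 := Subtype.ext this
    rw [this, map_one]

theorem coprod_fg (hA : Group.FG A) : Group.FG (CoprodI (fun _ : Bool => A)) := by
  obtain ⟨S, hS⟩ := hA.out
  rw [Group.fg_iff]
  refine ⟨(CoprodI.of (i := true) '' (S : Set A)) ∪ (CoprodI.of (i := false) '' (S : Set A)), ?_,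
    (S.finite_toSet.image _).union (S.finite_toSet.image _)⟩
  set K := Subgroup.closure ((CoprodI.of (M := fun _ : Bool => A) (i := true) '' (S : Set A)) ∪ (CoprodI.of (i := false) '' (S : Set A)))
  have h : ∀ (i : Bool) (a : A), CoprodI.of (M := fun _ : Bool => A) (i := i) a ∈ K := by
    intro i
    have : (⊤ : Subgroup A) ≤ K.comap (CoprodI.of (M := fun _ : Bool => A) (i := i)) := by
      rw [← hS, Subgroup.closure_le]
      intro s hs
      apply Subgroup.subset_closure
      cases i
      · exact Or.inr ⟨s, hs, rfl⟩
      · exact Or.inl ⟨s, hs, rfl⟩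
    intro a
    exact this (Subgroup.mem_top a)
  rw [eq_top_iff]
  intro x _
  induction x using CoprodI.induction_on with
  | one => exact K.one_mem
  | of i m => exact h i m
  | mul x y hx hy => exact K.mul_mem (hx trivial) (hy trivial)

abbrev kil (K : Subgroup A) : CoprodI (fun _ : Bool => A) →* Am K := PushoutI.ofCoprodI

theorem kil_mono {K L : Subgroup A} (h : K ≤ L) (x : CoprodI (fun _ : Bool => A))
    (hx : kil K x = 1) : kil L x = 1 := by
  let g : Am K →* Am L := PushoutI.lift (fun i => PushoutI.of (φ := fun _ : Bool => L.subtype) i)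
    ((PushoutI.base _).comp (Subgroup.inclusion h)) (by
      intro i
      ext c
      have := PushoutI.of_apply_eq_base (fun _ : Bool => L.subtype) i (Subgroup.inclusion h c)
      simpa using this)
  have : g.comp (kil K) = kil L := by
    apply CoprodI.ext_hom
    intro i
    ext a
    simp [g, kil]
  rw [← this, MonoidHom.comp_apply, hx, map_one]

def KD (C : Subgroup A) : Subgroup (CoprodI (fun _ : Bool => A)) where
  carrier := {x | ∃ K : Subgroup A, K ≤ C ∧ K.FG ∧ kil K x = 1}
  one_mem' := ⟨⊥, bot_le, Subgroup.FG.bot, map_one _⟩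
  mul_mem' := by
    rintro a b ⟨K, h1, h2, h3⟩ ⟨L, h4, h5, h6⟩
    refine ⟨K ⊔ L, sup_le h1 h4, h2.sup h5, ?_⟩
    rw [map_mul, kil_mono le_sup_left _ h3, kil_mono le_sup_right _ h6, one_mul]
  inv_mem' := by
    rintro a ⟨K, h1, h2, h3⟩
    exact ⟨K, h1, h2, by rw [map_inv, h3, inv_one]⟩

instance (C : Subgroup A) : (KD C).Normal where
  conj_mem := by
    rintro a ⟨K, h1, h2, h3⟩ g
    exact ⟨K, h1, h2, by simp [h3]⟩

theorem of_eq_iff {K : Subgroup A} {c : A}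
    (h : (PushoutI.of true c : Am K) = PushoutI.of false c) : c ∈ K := by
  have h1 : (PushoutI.of true c : Am K) ∈ (PushoutI.base (fun _ : Bool => K.subtype)).range := by
    rw [← PushoutI.inf_of_range_eq_base_range (fun _ => K.subtype_injective)
      (i := true) (j := false) (by simp)]
    exact ⟨⟨c, rfl⟩, ⟨c, h.symm⟩⟩
  obtain ⟨d, hd⟩ := h1
  rw [← PushoutI.of_apply_eq_base (fun _ : Bool => K.subtype) true] at hd
  have := PushoutI.of_injective (φ := fun _ : Bool => K.subtype) (fun _ => K.subtype_injective) true hd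
  rw [← this]; exact d.2

theorem ker_le_KD (C : Subgroup A) : (kil C).ker ≤ KD C := by
  have hc : ∀ c : C, ((CoprodI.of (M := fun _ : Bool => A) (i := true) (c : A)) :
      CoprodI (fun _ : Bool => A) ⧸ KD C) = (CoprodI.of (M := fun _ : Bool => A) (i := false) (c : A)) := by
    intro c
    rw [QuotientGroup.eq]
    refine ⟨Subgroup.zpowers (c : A), by simp, ⟨{(c : A)}, by simp [Subgroup.zpowers_eq_closure]⟩, ?_⟩
    have h1 := PushoutI.of_apply_eq_base (fun _ : Bool => (Subgroup.zpowers (c : A)).subtype) true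
      ⟨(c : A), Subgroup.mem_zpowers _⟩
    have h2 := PushoutI.of_apply_eq_base (fun _ : Bool => (Subgroup.zpowers (c : A)).subtype) false
      ⟨(c : A), Subgroup.mem_zpowers _⟩
    rw [← h2] at h1
    simp only [Subgroup.coe_subtype] at h1
    simp only [kil, map_mul, map_inv, PushoutI.ofCoprodI_of]
    rw [h1, inv_mul_cancel]
  let q := QuotientGroup.mk' (KD C)
  let g : Am C →* (CoprodI (fun _ : Bool => A) ⧸ KD C) :=
    PushoutI.lift (fun i => q.comp (CoprodI.of (M := fun _ : Bool => A) (i := i)))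
      ((q.comp (CoprodI.of (M := fun _ : Bool => A) (i := true))).comp C.subtype) (by
        intro i
        cases i
        · ext c
          exact (hc c).symm
        · rfl)
  have hg : g.comp (kil C) = q := by
    apply CoprodI.ext_hom
    intro i
    ext a
    simp [g, kil, q]
  intro x hx
  have : q x = 1 := by
    rw [← hg, MonoidHom.comp_apply, MonoidHom.mem_ker.1 hx, map_one]
  exact (QuotientGroup.eq_one_iff x).1 this

theorem am_not_fp (hA : Group.FG A) (C : Subgroup A) (hC : ¬ C.FG) :
    ¬ IsFinitelyPresented (Am C) := by
  intro hfp
  have hsurj : Function.Surjective (kil C) := by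
    intro y
    induction y using PushoutI.induction_on with
    | of i g => exact ⟨CoprodI.of (i := i) g, by simp [kil]⟩
    | base h => exact ⟨CoprodI.of (i := true) (h : A), by
        rw [kil, PushoutI.ofCoprodI_of]
        exact PushoutI.of_apply_eq_base (fun _ : Bool => C.subtype) true h⟩
    | mul x y hx hy =>
      obtain ⟨a, rfl⟩ := hx
      obtain ⟨b, rfl⟩ := hy
      exact ⟨a * b, map_mul _ _ _⟩
  obtain ⟨R, hRf, hRk, hRn⟩ := fp_kernel (coprod_fg hA) (kil C) hsurj hfp
  have : ∃ K : Subgroup A, K ≤ C ∧ K.FG ∧ ∀ r ∈ R, kil K r = 1 := by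
    clear hRn
    induction R, hRf using Set.Finite.induction_on with
    | empty => exact ⟨⊥, bot_le, Subgroup.FG.bot, by simp⟩
    | insert _ _ ih =>
      obtain ⟨K, h1, h2, h3⟩ := ih (fun x hx => hRk (Set.mem_insert_of_mem _ hx))
      obtain ⟨L, h4, h5, h6⟩ := ker_le_KD C (hRk (Set.mem_insert _ _))
      refine ⟨K ⊔ L, sup_le h1 h4, h2.sup h5, ?_⟩
      rintro r (rfl | hr)
      · exact kil_mono le_sup_right _ h6
      · exact kil_mono le_sup_left _ (h3 r hr)
  obtain ⟨K, hKC, hKfg, hK⟩ := this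
  apply hC
  convert hKfg
  apply le_antisymm _ hKC
  intro c hc
  apply of_eq_iff
  have hn : Subgroup.normalClosure R ≤ (kil K).ker := Subgroup.normalClosure_le_normal hK
  have h1 : CoprodI.of (M := fun _ : Bool => A) (i := true) c * (CoprodI.of (i := false) c)⁻¹ ∈ (kil C).ker := by
    have h1 := PushoutI.of_apply_eq_base (fun _ : Bool => C.subtype) true ⟨c, hc⟩
    have h2 := PushoutI.of_apply_eq_base (fun _ : Bool => C.subtype) false ⟨c, hc⟩
    rw [← h2] at h1
    simp only [Subgroup.coe_subtype] at h1
    simp only [MonoidHom.mem_ker, kil, map_mul, map_inv, PushoutI.ofCoprodI_of]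
    rw [h1, mul_inv_cancel]
  have h2 := hn (hRn h1)
  simp only [MonoidHom.mem_ker, kil, map_mul, map_inv, PushoutI.ofCoprodI_of] at h2
  exact mul_inv_eq_one.1 h2

theorem fp_equiv {G H : Type*} [Group G] [Group H] (e : G ≃* H) (h : IsFinitelyPresented G) :
    IsFinitelyPresented H := by
  obtain ⟨n, r, hr, ⟨g⟩⟩ := h
  exact ⟨n, r, hr, ⟨g.trans e⟩⟩

theorem amalgam_main {𝒢 X : Type*} [Group 𝒢] [MulAction 𝒢 X] (hA : Group.FG A) (C : Subgroup A)
    (hC : ¬ C.FG) (f : Bool → (A →* 𝒢))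
    (hfinj : ∀ c ∈ C, f true c = 1 → c = 1)
    (hk : ∀ c ∈ C, f false c = f true c)
    (D : Set X) (Y : Bool → Set X) (hYD : ∀ i, Y i ⊆ D) (hdisj : ∀ x, x ∈ Y true → x ∉ Y false)
    (x0 : X) (hx0 : x0 ∈ D) (hx0Y : ∀ i, x0 ∉ Y i) (hfix : ∀ c ∈ C, f true c • x0 ∈ D ∧ ∀ i, f true c • x0 ∉ Y i)
    (hpres : ∀ c ∈ C, ∀ i, ∀ y ∈ Y i, f true c • y ∈ Y i)
    (hpp : ∀ i a, a ∉ C → ∀ z ∈ D, z ∉ Y i → f i a • z ∈ Y i) :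
    ∃ H : Subgroup 𝒢, Group.FG H ∧ ¬ IsFinitelyPresented H ∧
      (∀ L : Subgroup 𝒢, (∀ i a, f i a ∈ L) → H ≤ L) := by
  have hk' : ∀ i, (f i).comp C.subtype = (f true).comp C.subtype := by
    intro i
    cases i
    · ext c; exact hk c c.2
    · rfl
  have hinj := am_inj C f hfinj ((f true).comp C.subtype) hk' D Y hYD (by
    intro i j hij x hx hx'
    cases i <;> cases j
    · exact hij rfl
    · exact hdisj x hx' hx
    · exact hdisj x hx hx'
    · exact hij rfl) x0 hx0 hx0Y (fun c => hfix c c.2) (fun c i y hy => hpres c c.2 i y hy) hpp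
  set Φ := PushoutI.lift (φ := fun _ : Bool => C.subtype) f _ hk'
  refine ⟨Φ.range, ?_, ?_, ?_⟩
  · have : Group.FG (CoprodI (fun _ : Bool => A)) := coprod_fg hA
    have h2 : Φ.range = (Φ.comp (kil C)).range := by
      apply le_antisymm
      · rintro _ ⟨y, rfl⟩
        induction y using PushoutI.induction_on with
        | of i g => exact ⟨CoprodI.of (i := i) g, by simp [kil]⟩
        | base h => exact ⟨CoprodI.of (i := true) (h : A), by
            rw [MonoidHom.comp_apply, kil, PushoutI.ofCoprodI_of]
            congr 1
            exact PushoutI.of_apply_eq_base (fun _ : Bool => C.subtype) true h⟩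
        | mul x y hx hy => rw [map_mul]; exact Subgroup.mul_mem _ hx hy
      · rintro _ ⟨y, rfl⟩
        exact ⟨_, rfl⟩
    rw [h2]
    exact Group.fg_range _
  · intro h
    exact am_not_fp hA C hC (fp_equiv (MonoidHom.ofInjective hinj).symm h)
  · intro L hL
    rintro _ ⟨y, rfl⟩
    induction y using PushoutI.induction_on with
    | of i g => simpa [Φ] using hL i g
    | base h => simpa [Φ] using hL true h
    | mul x y hx hy => rw [map_mul]; exact Subgroup.mul_mem _ hx hy

end amalgam
end Paper

namespace Paper
open Matrix

section cube

def IP {R : Type*} [CommRing R] (x y : Fin 4 → R) : R :=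
  -(x 0 * y 0) + x 1 * y 1 + x 2 * y 2 + x 3 * y 3

def al : Fin 8 → Fin 4 → ℤ := ![![1,1,1,1], ![1,-1,1,1], ![1,1,-1,1], ![1,-1,-1,1],
  ![1,1,1,-1], ![1,-1,1,-1], ![1,1,-1,-1], ![1,-1,-1,-1]]

def Jd : Fin 4 → ℤ := ![-1,1,1,1]

def Rm (i : Fin 8) : Matrix (Fin 4) (Fin 4) ℤ :=
  Matrix.of fun a b => (if a = b then 1 else 0) - al i a * (Jd b * al i b)

def cubeM : CoxeterMatrix (Fin 8) where
  M := Matrix.of fun i j => if i = j then 1 else if IP (al i) (al j) = 0 then 2 else 0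
  isSymm := by
    rw [Matrix.IsSymm]; decide +kernel
  diagonal := by decide +kernel
  off_diagonal := by
    intro i j hij
    simp only [Matrix.of_apply, if_neg hij]
    split <;> norm_num

abbrev W : Type := cubeM.Group
abbrev cs : CoxeterSystem cubeM W := cubeM.toCoxeterSystem

theorem Rm_lift : cubeM.IsLiftable Rm := by
  unfold CoxeterMatrix.IsLiftable
  decide +kernel

noncomputable def rho : W →* Matrix (Fin 4) (Fin 4) ℤ := cs.lift ⟨Rm, Rm_lift⟩

theorem rho_simple (i : Fin 8) : rho (cs.simple i) = Rm i := cs.lift_apply_simple Rm_lift i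

theorem Rm_mulVec (i : Fin 8) (x : Fin 4 → ℤ) : Rm i *ᵥ x = x - IP x (al i) • al i := by
  ext a
  simp only [Rm, Matrix.mulVec, dotProduct, Fin.sum_univ_four, IP, Jd, Matrix.of_apply,
    Pi.sub_apply, Pi.smul_apply, smul_eq_mul]
  fin_cases a <;> simp <;> ring

theorem al_self (i : Fin 8) : IP (al i) (al i) = 2 := by revert i; decide +kernel
theorem al_zero (i : Fin 8) : al i 0 = 1 := by revert i; decide +kernel
theorem al_pair (i j : Fin 8) : i = j ∨ IP (al i) (al j) = 0 ∨ IP (al i) (al j) ≤ -2 := by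
  revert i j; decide +kernel

section ip
variable {R : Type*} [CommRing R]
theorem IP_comm (x y : Fin 4 → R) : IP x y = IP y x := by simp [IP]; ring
theorem IP_add (x y z : Fin 4 → R) : IP (x + y) z = IP x z + IP y z := by simp [IP]; ring
theorem IP_add_r (x y z : Fin 4 → R) : IP z (x + y) = IP z x + IP z y := by simp [IP]; ring
theorem IP_sub (x y z : Fin 4 → R) : IP (x - y) z = IP x z - IP y z := by simp [IP]; ring
theorem IP_sub_r (x y z : Fin 4 → R) : IP z (x - y) = IP z x - IP z y := by simp [IP]; ring
theorem IP_smul (c : R) (x z : Fin 4 → R) : IP (c • x) z = c * IP x z := by simp [IP]; ring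
theorem IP_smul_r (c : R) (x z : Fin 4 → R) : IP z (c • x) = c * IP z x := by simp [IP]; ring

variable [LinearOrder R] [IsStrictOrderedRing R]

theorem rcs (x y : Fin 4 → R) (hx : IP x x < 0) : IP x x * IP y y ≤ IP x y ^ 2 := by
  have h0 : x 0 ≠ 0 := by
    intro h
    simp only [IP, h] at hx
    nlinarith [mul_self_nonneg (x 1), mul_self_nonneg (x 2), mul_self_nonneg (x 3)]
  have hp : 0 < x 0 ^ 2 := by positivity
  have hz : 0 ≤ y 0 ^ 2 * IP x x - 2 * x 0 * y 0 * IP x y + x 0 ^ 2 * IP y y := by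
    have : y 0 ^ 2 * IP x x - 2 * x 0 * y 0 * IP x y + x 0 ^ 2 * IP y y =
      (y 0 * x 1 - x 0 * y 1) ^ 2 + (y 0 * x 2 - x 0 * y 2) ^ 2 + (y 0 * x 3 - x 0 * y 3) ^ 2 := by
      simp only [IP]; ring
    rw [this]; positivity
  have key : x 0 ^ 2 * (IP x y ^ 2 - IP x x * IP y y) = (x 0 * IP x y - y 0 * IP x x) ^ 2
     - IP x x * (y 0 ^ 2 * IP x x - 2 * x 0 * y 0 * IP x y + x 0 ^ 2 * IP y y) := by ring
  have : 0 ≤ x 0 ^ 2 * (IP x y ^ 2 - IP x x * IP y y) := by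
    rw [key]
    nlinarith [sq_nonneg (x 0 * IP x y - y 0 * IP x x)]
  have := nonneg_of_mul_nonneg_right this hp
  linarith

def Fwd (x : Fin 4 → R) : Prop := IP x x < 0 ∧ 0 < x 0

theorem fwd_neg (x u : Fin 4 → R) (hx : Fwd x) (hu : IP u u ≤ 0) (hu0 : 0 < u 0) : IP x u < 0 := by
  obtain ⟨h1, h2⟩ := hx
  simp only [IP] at *
  have hc : (x 1 * u 1 + x 2 * u 2 + x 3 * u 3) ^ 2 ≤
      (x 1 * x 1 + x 2 * x 2 + x 3 * x 3) * (u 1 * u 1 + u 2 * u 2 + u 3 * u 3) := by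
    nlinarith [sq_nonneg (x 1 * u 2 - x 2 * u 1), sq_nonneg (x 1 * u 3 - x 3 * u 1),
      sq_nonneg (x 2 * u 3 - x 3 * u 2)]
  have hX : 0 ≤ x 1 * x 1 + x 2 * x 2 + x 3 * x 3 := by
    linarith [mul_self_nonneg (x 1), mul_self_nonneg (x 2), mul_self_nonneg (x 3)]
  have h3 : (x 1 * u 1 + x 2 * u 2 + x 3 * u 3) ^ 2 < (x 0 * u 0) ^ 2 := by
    calc _ ≤ _ := hc
      _ ≤ (x 1 * x 1 + x 2 * x 2 + x 3 * x 3) * (u 0 * u 0) := by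
        apply mul_le_mul_of_nonneg_left _ hX
        linarith
      _ < (x 0 * x 0) * (u 0 * u 0) := by
        apply mul_lt_mul_of_pos_right _ (by positivity)
        linarith
      _ = _ := by ring
  have := abs_lt_of_sq_lt_sq h3 (by positivity)
  have := (abs_lt.1 this).2
  linarith
end ip

def oo : Fin 4 → ℤ := ![1,0,0,0]
theorem oo_fwd : Fwd oo := by constructor <;> simp [IP, oo]
theorem oo_al (i : Fin 8) : IP oo (al i) = -1 := by revert i; decide +kernel

theorem Rm_IP (i : Fin 8) (x y : Fin 4 → ℤ) : IP (Rm i *ᵥ x) (Rm i *ᵥ y) = IP x y := by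
  rw [Rm_mulVec, Rm_mulVec]
  simp only [IP_sub, IP_sub_r, IP_smul, IP_smul_r, al_self, IP_comm (al i) y]
  ring

theorem Rm_fwd (i : Fin 8) (x : Fin 4 → ℤ) (hx : Fwd x) : Fwd (Rm i *ᵥ x) := by
  refine ⟨by rw [Rm_IP]; exact hx.1, ?_⟩
  have h : (Rm i *ᵥ x) 0 = - IP x (oo + al i) := by
    rw [Rm_mulVec]
    simp [al_zero, IP_add_r]
    simp [IP, oo]
    ring_nf
  rw [h]
  have hu : IP (oo + al i) (oo + al i) ≤ 0 := by
    clear h; revert i; decide +kernel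
  have hu0 : 0 < (oo + al i) 0 := by
    simp [al_zero, oo]
  linarith [fwd_neg x _ hx hu hu0]

theorem rho_fwd (g : W) (x : Fin 4 → ℤ) (hx : Fwd x) : Fwd (rho g *ᵥ x) := by
  induction g using cs.simple_induction_left with
  | one => simpa using hx
  | mul_simple_left w i ih => rw [map_mul, rho_simple, ← mulVec_mulVec]; exact Rm_fwd _ _ ih

theorem rho_IP (g : W) (x y : Fin 4 → ℤ) : IP (rho g *ᵥ x) (rho g *ᵥ y) = IP x y := by
  induction g using cs.simple_induction_left with
  | one => simp
  | mul_simple_left w i ih =>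
    rw [map_mul, rho_simple, ← mulVec_mulVec, ← mulVec_mulVec, Rm_IP, ih]

theorem rho_inv_mul (g : W) (x : Fin 4 → ℤ) : rho g⁻¹ *ᵥ (rho g *ᵥ x) = x := by
  rw [mulVec_mulVec, ← map_mul]; simp

theorem rho_mul_inv (g : W) (x : Fin 4 → ℤ) : rho g *ᵥ (rho g⁻¹ *ᵥ x) = x := by
  rw [mulVec_mulVec, ← map_mul]; simp

theorem rho_IP_inv (g : W) (x y : Fin 4 → ℤ) : IP (rho g *ᵥ x) y = IP x (rho g⁻¹ *ᵥ y) := by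
  rw [← rho_IP g x, rho_mul_inv]

theorem comm_adj {i j : Fin 8} (h : IP (al i) (al j) = 0) :
    cs.simple i * cs.simple j = cs.simple j * cs.simple i := by
  have h1 := cs.simple_mul_simple_pow i j
  have hij : i ≠ j := by rintro rfl; rw [al_self] at h; norm_num at h
  have h2 : cubeM i j = 2 := by
    show (if i = j then 1 else if IP (al i) (al j) = 0 then 2 else 0) = 2
    rw [if_neg hij, if_pos h]
  rw [h2, pow_two] at h1
  have h3 := mul_eq_one_iff_eq_inv.1 h1
  rw [h3, _root_.mul_inv_rev, cs.inv_simple, cs.inv_simple]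

theorem desc_key (m : ℕ) : ∀ g : W, cs.length g = m → ∀ i,
    (cs.IsLeftDescent g i → 0 < IP (rho g *ᵥ oo) (al i)) ∧
    (¬ cs.IsLeftDescent g i → IP (rho g *ᵥ oo) (al i) < 0) := by
  induction m using Nat.strong_induction_on with
  | _ m IH =>
  intro g hg
  have hd : ∀ i, cs.IsLeftDescent g i → 0 < IP (rho g *ᵥ oo) (al i) := by
    intro i hi
    have hz := (IH (cs.length (cs.simple i * g)) (hg ▸ hi) _ rfl i).2
      (cs.isLeftDescent_iff_not_isLeftDescent_mul.1 hi)
    rw [map_mul, rho_simple, ← mulVec_mulVec, Rm_mulVec, IP_sub, IP_smul, al_self] at hz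
    linarith
  intro i
  refine ⟨hd i, fun hi => ?_⟩
  by_cases h1 : g = 1
  · subst h1
    simp [oo_al]
  obtain ⟨j, hj⟩ := cs.exists_leftDescent_of_ne_one h1
  have hj' := hd j hj
  rcases al_pair i j with rfl | h | h
  · exact absurd hj hi
  · have hni : ¬ cs.IsLeftDescent (cs.simple j * g) i := by
      rw [cs.not_isLeftDescent_iff] at hi ⊢
      rw [cs.isLeftDescent_iff] at hj
      have h3 := cs.length_simple_mul (cs.simple i * g) j
      rw [← mul_assoc, ← comm_adj h, mul_assoc] at h3
      have h4 := cs.length_simple_mul (cs.simple j * g) i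
      omega
    have hz := (IH (cs.length (cs.simple j * g)) (hg ▸ hj) _ rfl i).2 hni
    rw [map_mul, rho_simple, ← mulVec_mulVec, Rm_mulVec, IP_sub, IP_smul, IP_comm (al j), h] at hz
    linarith
  · have h0 : 0 < (al i + al j) 0 := by simp [al_zero]
    have h2 : IP (al i + al j) (al i + al j) ≤ 0 := by
      simp only [IP_add, IP_add_r, al_self, IP_comm (al j) (al i)]; linarith
    have h3 := fwd_neg _ _ (rho_fwd g _ oo_fwd) h2 h0
    rw [IP_add_r] at h3
    linarith

theorem rho_faithful (g : W) (h : rho g = 1) : g = 1 := by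
  by_contra h1
  obtain ⟨j, hj⟩ := cs.exists_leftDescent_of_ne_one h1
  have := (desc_key _ g rfl j).1 hj
  rw [h, one_mulVec, oo_al] at this
  norm_num at this

theorem rho_inj : Function.Injective rho := by
  intro a b h
  have : rho (a * b⁻¹) = 1 := by rw [map_mul, h, ← map_mul]; simp
  exact mul_inv_eq_one.1 (rho_faithful _ this)

end cube
end Paper

namespace Paper
open Matrix

section words

abbrev Q4 : Type := ℤ × ℤ × ℤ × ℤ
def vec (p : Q4) : Fin 4 → ℤ := ![p.1, p.2.1, p.2.2.1, p.2.2.2]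

def st (i : Fin 8) (p : Q4) : Q4 :=
  (p.1 - (-p.1 + p.2.1 * al i 1 + p.2.2.1 * al i 2 + p.2.2.2 * al i 3),
   p.2.1 - (-p.1 + p.2.1 * al i 1 + p.2.2.1 * al i 2 + p.2.2.2 * al i 3) * al i 1,
   p.2.2.1 - (-p.1 + p.2.1 * al i 1 + p.2.2.1 * al i 2 + p.2.2.2 * al i 3) * al i 2,
   p.2.2.2 - (-p.1 + p.2.1 * al i 1 + p.2.2.1 * al i 2 + p.2.2.2 * al i 3) * al i 3)

def run : List (Fin 8) → Q4 → Q4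
  | [], p => p
  | i :: l, p => st i (run l p)

theorem run_spec (l : List (Fin 8)) (p : Q4) : rho (cs.wordProd l) *ᵥ vec p = vec (run l p) := by
  induction l with
  | nil => simp [run]
  | cons i l ih =>
    rw [cs.wordProd_cons, map_mul, ← mulVec_mulVec, ih, rho_simple, Rm_mulVec]
    ext a
    have := al_zero i
    fin_cases a <;> simp [run, st, vec, IP, this]

theorem vec_surj (x : Fin 4 → ℤ) : x = vec (x 0, x 1, x 2, x 3) := by
  ext a; fin_cases a <;> rfl

theorem mat_ext {M M' : Matrix (Fin 4) (Fin 4) ℤ}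
    (h1 : M *ᵥ vec (1,0,0,0) = M' *ᵥ vec (1,0,0,0)) (h2 : M *ᵥ vec (0,1,0,0) = M' *ᵥ vec (0,1,0,0))
    (h3 : M *ᵥ vec (0,0,1,0) = M' *ᵥ vec (0,0,1,0)) (h4 : M *ᵥ vec (0,0,0,1) = M' *ᵥ vec (0,0,0,1)) :
    M = M' := by
  ext a b
  have h1 := congrFun h1 a
  have h2 := congrFun h2 a
  have h3 := congrFun h3 a
  have h4 := congrFun h4 a
  simp [mulVec, dotProduct, Fin.sum_univ_four, vec] at h1 h2 h3 h4
  fin_cases b <;> simpa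

def same (l l' : List (Fin 8)) : Prop :=
  run l (1,0,0,0) = run l' (1,0,0,0) ∧ run l (0,1,0,0) = run l' (0,1,0,0) ∧
  run l (0,0,1,0) = run l' (0,0,1,0) ∧ run l (0,0,0,1) = run l' (0,0,0,1)

instance (l l' : List (Fin 8)) : Decidable (same l l') := by unfold same; infer_instance

theorem word_eq {l l' : List (Fin 8)} (h : same l l') : cs.wordProd l = cs.wordProd l' := by
  apply rho_inj
  obtain ⟨h1, h2, h3, h4⟩ := h
  apply mat_ext <;> rw [run_spec, run_spec] <;> simp only [*]

def ag : Fin 5 → List (Fin 8) := ![[0,3], [0,2,5,1], [0,2,7,3], [0,2,5,4], [0,2,6,4]]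

/-- letters: `(k, true)` is the generator `k`, `(k, false)` its inverse. -/
def gl : List (Fin 5 × Bool) → List (Fin 8)
  | [] => []
  | (k, true) :: l => ag k ++ gl l
  | (k, false) :: l => (ag k).reverse ++ gl l

def sw : List (Fin 8) := [1,3,4,6]

noncomputable def ss : W := cs.wordProd sw
noncomputable def c0 : W := cs.wordProd [2,3,4,5]

noncomputable def AA : Subgroup W := Subgroup.closure (Set.range fun k => cs.wordProd (ag k))

theorem ag_mem (k : Fin 5) : cs.wordProd (ag k) ∈ AA := Subgroup.subset_closure ⟨k, rfl⟩

theorem gl_mem (l : List (Fin 5 × Bool)) : cs.wordProd (gl l) ∈ AA := by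
  induction l with
  | nil => simp [gl, AA.one_mem]
  | cons p l ih =>
    obtain ⟨k, b⟩ := p
    cases b
    · simp only [gl, cs.wordProd_append, cs.wordProd_reverse]
      exact AA.mul_mem (AA.inv_mem (ag_mem k)) ih
    · simp only [gl, cs.wordProd_append]
      exact AA.mul_mem (ag_mem k) ih

def cj1 : Fin 5 → List (Fin 5 × Bool) := ![
  [(0, false), (1, false), (3, true), (4, true), (3, false), (1, true), (0, true), (1, false), (3, true), (4, false), (3, false), (1, true), (0, true)],
  [(0, false), (1, false), (3, true), (4, true), (3, false), (1, true), (0, true), (2, false), (3, true), (4, false), (2, true), (0, false), (3, false), (1, true), (0, true)],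
  [(0, false), (1, false), (3, true), (4, true), (3, false), (1, true), (0, true), (1, false), (3, true), (4, false), (2, true), (0, false), (3, false), (1, true), (0, true)],
  [(0, false), (1, false), (3, true), (4, true), (0, true), (2, false), (3, true), (4, false), (2, true), (0, false), (3, false), (1, true), (0, true)],
  [(0, false), (1, false), (3, true), (4, true), (3, false), (1, true), (0, true)]]

def cj2 : Fin 5 → List (Fin 5 × Bool) := ![
  [(4, false), (0, true), (4, true)],
  [(4, false), (0, true), (1, true), (3, false), (4, true), (0, false), (2, true), (4, false), (3, true), (2, false), (4, true)],
  [(4, false), (0, true), (1, true), (3, false), (4, true), (0, false), (2, true), (4, false), (3, true), (1, false), (4, true)],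
  [(4, false), (0, true), (1, true), (3, false), (4, true), (0, false), (2, true), (4, false), (3, true), (2, false), (0, true), (3, true), (1, false), (0, false), (4, true)],
  [(4, false), (0, true), (1, true), (3, false), (4, true), (3, true), (1, false), (0, false), (4, true)]]

theorem cj1_spec : ∀ k : Fin 5, same (sw ++ ag k ++ sw.reverse) (gl (cj1 k)) := by
  decide +kernel

theorem cj2_spec : ∀ k : Fin 5, same (sw.reverse ++ ag k ++ sw) (gl (cj2 k)) := by
  decide +kernel

theorem conj_AA (a : W) (ha : a ∈ AA) : ss * a * ss⁻¹ ∈ AA := by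
  have : AA ≤ AA.comap (MulAut.conj ss).toMonoidHom := by
    conv_lhs => rw [AA]
    rw [Subgroup.closure_le]
    rintro _ ⟨k, rfl⟩
    have := word_eq (cj1_spec k)
    simp only [cs.wordProd_append, cs.wordProd_reverse] at this
    simp only [Subgroup.coe_comap, Set.mem_preimage, SetLike.mem_coe]
    show ss * cs.wordProd (ag k) * ss⁻¹ ∈ AA
    rw [ss, this]
    exact gl_mem _
  exact this ha

theorem conj_AA' (a : W) (ha : a ∈ AA) : ss⁻¹ * a * ss ∈ AA := by
  have : AA ≤ AA.comap (MulAut.conj ss⁻¹).toMonoidHom := by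
    conv_lhs => rw [AA]
    rw [Subgroup.closure_le]
    rintro _ ⟨k, rfl⟩
    have := word_eq (cj2_spec k)
    simp only [cs.wordProd_append, cs.wordProd_reverse] at this
    simp only [Subgroup.coe_comap, Set.mem_preimage, SetLike.mem_coe]
    show ss⁻¹ * cs.wordProd (ag k) * ss⁻¹⁻¹ ∈ AA
    rw [ss, inv_inv, this]
    exact gl_mem _
  have := this ha
  simpa using this

theorem c0_mem : c0 ∈ AA := by
  have h : same [2,3,4,5] (gl [(0,false),(3,true)]) := by decide +kernel
  rw [c0, word_eq h]
  exact gl_mem _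

end words
end Paper

namespace Paper
open Matrix

section character

def ev : Fin 8 → Bool := ![true, false, false, true, false, true, true, false]
def eta : Fin 8 → ℤ := ![1, 1, -1, 1, 1, -1, -1, -1]

def act (i : Fin 8) (z : ℤ × ℤ) : ℤ × ℤ :=
  if ev i then (eta i - z.1, z.2) else (z.1, eta i - z.2)

def actE (i : Fin 8) : Function.End (ℤ × ℤ) := act i

theorem ev_adj : ∀ i j : Fin 8, IP (al i) (al j) = 0 → ev i = !ev j := by decide +kernel

theorem act_lift : cubeM.IsLiftable actE := by
  intro i j
  have hM : cubeM i j = if i = j then 1 else if IP (al i) (al j) = 0 then 2 else 0 := rfl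
  rw [hM]
  split_ifs with h1 h2
  · subst h1
    funext z
    show act i (act i z) = z
    unfold act
    cases ev i <;> simp
  · funext z
    have := ev_adj i j h2
    show act i (act j (act i (act j z))) = z
    unfold act
    rw [this]
    cases ev j <;> simp
  · simp

noncomputable def psi : W →* Function.End (ℤ × ℤ) := cs.lift ⟨actE, act_lift⟩

theorem psi_simple (i : Fin 8) : psi (cs.simple i) = actE i := cs.lift_apply_simple act_lift i

theorem psi_mul (g h : W) (z : ℤ × ℤ) : psi (g * h) z = psi g (psi h z) := by
  rw [map_mul]; rfl

def Tr (g : W) (n : ℤ) : Prop := ∃ p q : ℤ, p + q = n ∧ ∀ z, psi g z = (z.1 + p, z.2 + q)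

theorem Tr_one {n : ℤ} (h : Tr 1 n) : n = 0 := by
  obtain ⟨p, q, rfl, h⟩ := h
  have := h (0, 0)
  rw [map_one] at this
  have h2 : ((0, 0) : ℤ × ℤ) = (0 + p, 0 + q) := this
  simp at h2
  omega

theorem Tr_one' : Tr 1 0 := ⟨0, 0, by simp, fun z => by rw [map_one]; simp [Function.End.one_def]⟩

theorem Tr_mul {g h : W} {n m : ℤ} (h1 : Tr g n) (h2 : Tr h m) : Tr (g * h) (n + m) := by
  obtain ⟨p, q, rfl, h1⟩ := h1
  obtain ⟨p', q', rfl, h2⟩ := h2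
  refine ⟨p' + p, q' + q, by ring, fun z => ?_⟩
  rw [psi_mul, h2, h1]
  ext <;> simp <;> ring

theorem Tr_inv {g : W} {n : ℤ} (h1 : Tr g n) : Tr g⁻¹ (-n) := by
  obtain ⟨p, q, rfl, h1⟩ := h1
  refine ⟨-p, -q, by ring, fun z => ?_⟩
  have h2 : psi g⁻¹ (psi g (z.1 - p, z.2 - q)) = (z.1 - p, z.2 - q) := by
    rw [← psi_mul]; simp [Function.End.one_def]
  rw [h1] at h2
  simp at h2
  rw [h2]
  ext <;> simp <;> ring

theorem Tr_pow {g : W} {n : ℤ} (h1 : Tr g n) (k : ℕ) : Tr (g ^ k) (k * n) := by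
  induction k with
  | zero => simpa using Tr_one'
  | succ k ih =>
    rw [pow_succ]
    convert Tr_mul ih h1 using 1
    push_cast; ring

theorem psi_word (l : List (Fin 8)) (z : ℤ × ℤ) : psi (cs.wordProd l) z = l.foldr act z := by
  induction l with
  | nil => simp [Function.End.one_def]
  | cons i l ih =>
    rw [cs.wordProd_cons, psi_mul, ih, psi_simple]; rfl

theorem Tr_ag (k : Fin 5) : Tr (cs.wordProd (ag k)) 0 := by
  have aux : ∀ (l : List (Fin 8)) (p : ℤ), (∀ z : ℤ × ℤ, l.foldr act z = (z.1 + p, z.2 - p)) →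
      Tr (cs.wordProd l) 0 := by
    intro l p h
    exact ⟨p, -p, by ring, fun z => by rw [psi_word, h]; rfl⟩
  refine aux _ (((ag k).foldr act (0, 0)).1) (fun z => ?_)
  fin_cases k
  all_goals
    simp [ag, act, ev, eta]
  all_goals (try constructor)
  all_goals ring

theorem Tr_AA (a : W) (ha : a ∈ AA) : Tr a 0 := by
  rw [AA] at ha
  induction ha using Subgroup.closure_induction with
  | mem x hx => obtain ⟨k, rfl⟩ := hx; exact Tr_ag k
  | one => exact Tr_one'
  | mul a b _ _ h1 h2 => simpa using Tr_mul h1 h2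
  | inv a _ h => simpa using Tr_inv h

theorem Tr_ss : ∃ t : ℤ, t ≠ 0 ∧ Tr ss t := by
  let p := (sw.foldr act (0, 0)).1
  let q := (sw.foldr act (0, 0)).2
  have hp : p + q ≠ 0 := by decide +kernel
  refine ⟨p + q, hp, p, q, rfl, fun z => ?_⟩
  rw [ss, psi_word]
  simp [sw, act, ev, eta, p, q]
  try constructor
  all_goals ring

end character
end Paper

namespace Paper
open Matrix

section stab

def ee : Fin 4 → ℤ := vec (0,1,1,1)
def ww : Fin 4 → ℤ := vec (0,-2,1,1)

theorem c0_run (p : Q4) : rho c0 *ᵥ vec p = vec (run [2,3,4,5] p) := run_spec _ _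
theorem c0_inv : c0⁻¹ = cs.wordProd [5,4,3,2] := by
  rw [c0, ← cs.wordProd_reverse]; rfl
theorem c0i_run (p : Q4) : rho c0⁻¹ *ᵥ vec p = vec (run [5,4,3,2] p) := by
  rw [c0_inv, run_spec]

theorem c0_e : rho c0 *ᵥ ee = ee := by rw [ee, c0_run]; congr 1
theorem c0_w : rho c0 *ᵥ ww = ww := by rw [ww, c0_run]; congr 1
theorem c0i_e : rho c0⁻¹ *ᵥ ee = ee := by rw [ee, c0i_run]; congr 1
theorem c0i_w : rho c0⁻¹ *ᵥ ww = ww := by rw [ww, c0i_run]; congr 1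

theorem c0_xy (x y : ℤ) : rho c0 *ᵥ vec (x,0,y,-y) = vec (17*x-24*y,0,17*y-12*x,-(17*y-12*x)) := by
  rw [c0_run]; congr 1
  simp [run, st, al]
  refine ⟨?_, ?_, ?_, ?_⟩ <;> ring
theorem c0i_xy (x y : ℤ) : rho c0⁻¹ *ᵥ vec (x,0,y,-y) = vec (17*x+24*y,0,17*y+12*x,-(17*y+12*x)) := by
  rw [c0i_run]; congr 1
  simp [run, st, al]
  refine ⟨?_, ?_, ?_, ?_⟩ <;> ring

theorem oo_vec : oo = vec (1,0,0,0) := rfl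

def Fx (g : W) : Prop := rho g *ᵥ ee = ee ∧ rho g *ᵥ ww = ww

theorem Fx_mul {g h : W} (hg : Fx g) (hh : Fx h) : Fx (g * h) := by
  constructor <;> rw [map_mul, ← mulVec_mulVec]
  · rw [hh.1, hg.1]
  · rw [hh.2, hg.2]

theorem Fx_c0 : Fx c0 := ⟨c0_e, c0_w⟩
theorem Fx_c0i : Fx c0⁻¹ := ⟨c0i_e, c0i_w⟩

theorem Fx_form {g : W} (hg : Fx g) : ∃ x y : ℤ, 0 < x ∧ x ^ 2 = 2 * y ^ 2 + 1 ∧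
    rho g *ᵥ oo = vec (x, 0, y, -y) := by
  have h1 := rho_IP g oo ee
  have h2 := rho_IP g oo ww
  have h3 := rho_IP g oo oo
  have h4 := (rho_fwd g _ oo_fwd).2
  rw [hg.1] at h1
  rw [hg.2] at h2
  set v := rho g *ᵥ oo
  simp [IP, ee, ww, vec, oo] at h1 h2 h3
  have e1 : v 1 = 0 := by linarith
  have e3 : v 3 = - v 2 := by linarith
  refine ⟨v 0, v 2, h4, ?_, ?_⟩
  · rw [e1, e3] at h3; nlinarith
  · rw [vec_surj v]; simp [vec, e1, e3]

def Mc : Matrix (Fin 4) (Fin 4) ℤ := !![17,0,-12,12; 0,1,0,0; -12,0,9,-8; 12,0,-8,9]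
def Mci : Matrix (Fin 4) (Fin 4) ℤ := !![17,0,12,-12; 0,1,0,0; 12,0,9,-8; -12,0,-8,9]

theorem rho_c0 : rho c0 = Mc := by
  apply mat_ext <;> rw [c0_run] <;> decide +kernel
theorem rho_c0i : rho c0⁻¹ = Mci := by
  apply mat_ext <;> rw [c0i_run] <;> decide +kernel

theorem base_case {M : Matrix (Fin 4) (Fin 4) ℤ} {x y : ℤ}
    (hM : ∀ u v, IP (M *ᵥ u) (M *ᵥ v) = IP u v) (he : M *ᵥ ee = ee) (hw : M *ᵥ ww = ww)
    (ho : M *ᵥ oo = vec (x, 0, y, -y)) (hxy : (x = 1 ∧ y = 0) ∨ (x = 3 ∧ y = 2) ∨ (x = 3 ∧ y = -2)) :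
    M * M = 1 ∨ M * M = Mc ∨ M * M = Mci := by
  have a0 := congrFun he 0
  have a1 := congrFun he 1
  have a2 := congrFun he 2
  have a3 := congrFun he 3
  have b0 := congrFun hw 0
  have b1 := congrFun hw 1
  have b2 := congrFun hw 2
  have b3 := congrFun hw 3
  have d0 := congrFun ho 0
  have d1 := congrFun ho 1
  have d2 := congrFun ho 2
  have d3 := congrFun ho 3
  have f1 := hM (vec (0,0,1,0)) ee
  have f2 := hM (vec (0,0,1,0)) ww
  have f3 := hM (vec (0,0,1,0)) oo
  have f4 := hM (vec (0,0,1,0)) (vec (0,0,1,0))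
  rw [he] at f1
  rw [hw] at f2
  rw [ho] at f3
  clear hM he hw ho
  simp [mulVec, dotProduct, Fin.sum_univ_four, vec, ee, ww, oo, IP] at a0 a1 a2 a3 b0 b1 b2 b3 d0 d1 d2 d3 f1 f2 f3 f4
  have k1 : M 1 2 = 0 := by linarith
  have k3 : M 3 2 = 1 - M 2 2 := by linarith
  have g0 : M 0 1 = 0 := by linarith
  have g1 : M 1 1 = 1 := by linarith
  have g2 : M 2 1 = 0 := by linarith
  have g3 : M 3 1 = 0 := by linarith
  have j0 : M 0 3 = - M 0 2 := by linarith
  have j1 : M 1 3 = 0 := by linarith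
  have j2 : M 2 3 = 1 - M 2 2 := by linarith
  have j3 : M 3 3 = M 2 2 := by linarith
  rw [k1, k3] at f4
  rw [k3] at f3
  have hMe : M = !![M 0 0, M 0 1, M 0 2, M 0 3; M 1 0, M 1 1, M 1 2, M 1 3;
     M 2 0, M 2 1, M 2 2, M 2 3; M 3 0, M 3 1, M 3 2, M 3 3] := by
    ext a b; fin_cases a <;> fin_cases b <;> rfl
  rw [d0, d1, d2, d3, g0, g1, g2, g3, j0, j1, j2, j3, k1, k3] at hMe
  clear a0 a1 a2 a3 b0 b1 b2 b3 d0 d1 d2 d3 f1 f2 k1 k3 g0 g1 g2 g3 j0 j1 j2 j3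
  generalize M 0 2 = c at *
  generalize M 2 2 = d at *
  rw [hMe]
  clear hMe
  rcases hxy with ⟨rfl, rfl⟩ | ⟨rfl, rfl⟩ | ⟨rfl, rfl⟩
  · have hc : c = 0 := by linarith
    subst hc
    have : d * (d - 1) = 0 := by nlinarith
    rcases mul_eq_zero.1 this with h | h
    · subst h; decide +kernel
    · obtain rfl : d = 1 := by linarith
      decide +kernel
  · have hd : 3 * c = 4 * d - 2 := by linarith
    have hd2 : (3 * c) ^ 2 = (4 * d - 2) ^ 2 := by rw [hd]
    have : (c - 2) * (c + 2) = 0 := by linarith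
    rcases mul_eq_zero.1 this with h | h
    · obtain rfl : c = 2 := by linarith
      obtain rfl : d = 2 := by linarith
      decide +kernel
    · obtain rfl : c = -2 := by linarith
      obtain rfl : d = -1 := by linarith
      decide +kernel
  · have hd : 3 * c = - (4 * d - 2) := by linarith
    have hd2 : (3 * c) ^ 2 = (4 * d - 2) ^ 2 := by rw [hd]; ring
    have : (c - 2) * (c + 2) = 0 := by linarith
    rcases mul_eq_zero.1 this with h | h
    · obtain rfl : c = 2 := by linarith
      obtain rfl : d = -1 := by linarith
      decide +kernel
    · obtain rfl : c = -2 := by linarith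
      obtain rfl : d = 2 := by linarith
      decide +kernel

theorem Tr_c0 : Tr c0 0 := Tr_AA _ c0_mem

theorem stab_lemma (m : ℕ) : ∀ (h : W) (n : ℤ), Fx h → Tr h n → (rho h *ᵥ oo) 0 ≤ m → n = 0 := by
  induction m with
  | zero =>
    intro h n _ _ hm
    have := (rho_fwd h _ oo_fwd).2
    push_cast at hm
    omega
  | succ m IH =>
    intro h n hF hT hm
    obtain ⟨x, y, hx, hxy, ho⟩ := Fx_form hF
    rw [ho] at hm
    have hm' : x ≤ m + 1 := by simpa [vec] using hm
    by_cases hx3 : x ≤ 3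
    · have hcase : (x = 1 ∧ y = 0) ∨ (x = 3 ∧ y = 2) ∨ (x = 3 ∧ y = -2) := by
        have hy1 : y ≤ 2 := by nlinarith
        have hy2 : -2 ≤ y := by nlinarith
        interval_cases x <;> interval_cases y <;> simp_all
      have hsq := base_case (rho_IP h) hF.1 hF.2 ho hcase
      have hT2 := Tr_mul hT hT
      rw [← rho_c0, ← rho_c0i, ← map_mul, ← map_one rho] at hsq
      rcases hsq with hs | hs | hs
      · rw [rho_inj hs] at hT2
        have := Tr_one hT2
        omega
      · rw [rho_inj hs] at hT2
        have := Tr_mul hT2 (Tr_inv Tr_c0)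
        rw [mul_inv_cancel] at this
        have := Tr_one this
        omega
      · rw [rho_inj hs] at hT2
        have := Tr_mul hT2 Tr_c0
        rw [inv_mul_cancel] at this
        have := Tr_one this
        omega
    · have hx3 : 3 < x := not_le.1 hx3
      rcases le_or_gt 0 y with hy | hy
      · have h2 := IH (c0 * h) n (Fx_mul Fx_c0 hF) (by simpa using Tr_mul Tr_c0 hT)
        apply h2
        rw [map_mul, ← mulVec_mulVec, ho, c0_xy]
        have : 2 * x < 3 * y := by
          by_contra hcon
          have hcon := not_lt.1 hcon
          nlinarith
        simp [vec]; linarith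
      · have h2 := IH (c0⁻¹ * h) n (Fx_mul Fx_c0i hF) (by simpa using Tr_mul (Tr_inv Tr_c0) hT)
        apply h2
        rw [map_mul, ← mulVec_mulVec, ho, c0i_xy]
        have : 2 * x < -3 * y := by
          by_contra hcon
          have hcon := not_lt.1 hcon
          nlinarith
        simp [vec]; linarith

theorem stab_zero (h : W) (n : ℤ) (hF : Fx h) (hT : Tr h n) : n = 0 :=
  stab_lemma ((rho h *ᵥ oo) 0).toNat h n hF hT (Int.self_le_toNat _)

end stab
end Paper

namespace Paper
open Matrix

section congr

noncomputable def rhoN (N : ℕ) : W →* Matrix (Fin 4) (Fin 4) (ZMod N) :=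
  ((Int.castRingHom (ZMod N)).mapMatrix.toMonoidHom).comp rho

noncomputable def Gam (N : ℕ) : Subgroup W := (rhoN N).toHomUnits.ker

theorem mem_Gam {N : ℕ} {g : W} : g ∈ Gam N ↔ ∀ a b, (N : ℤ) ∣ (rho g - 1) a b := by
  have h1 : g ∈ Gam N ↔ (rhoN N) g = 1 := by
    rw [Gam, MonoidHom.mem_ker, Units.ext_iff]; rfl
  rw [h1, ← sub_eq_zero]
  have h2 : rhoN N g - 1 = (Int.castRingHom (ZMod N)).mapMatrix (rho g - 1) := by
    rw [map_sub, map_one]; rfl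
  rw [h2, ← Matrix.ext_iff]
  simp only [RingHom.mapMatrix_apply, Matrix.map_apply, Matrix.zero_apply, eq_intCast,
    ZMod.intCast_zmod_eq_zero_iff_dvd]

instance (N : ℕ) : (Gam N).Normal := by unfold Gam; infer_instance

theorem Gam_fi (N : ℕ) [NeZero N] : (Gam N).FiniteIndex := by
  have : Finite (Matrix (Fin 4) (Fin 4) (ZMod N)) := by unfold Matrix; infer_instance
  have : Finite (Matrix (Fin 4) (Fin 4) (ZMod N))ˣ := inferInstance
  unfold Gam
  exact Subgroup.finiteIndex_ker _

noncomputable def AN (N : ℕ) : Subgroup W := AA ⊓ Gam N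

theorem sg_fg_map {G G' : Type*} [Group G] [Group G'] {H : Subgroup G} (f : G →* G') (h : H.FG) :
    (H.map f).FG := by
  classical
  obtain ⟨S, hS⟩ := h
  exact ⟨S.image f, by rw [Finset.coe_image, ← MonoidHom.map_closure, hS]⟩

theorem AN_fg (N : ℕ) [NeZero N] : Group.FG (AN N) := by
  have hA : AA.FG := ⟨(Set.finite_range fun k => cs.wordProd (ag k)).toFinset, by simp [AA]⟩
  have : Group.FG AA := (Group.fg_iff_subgroup_fg AA).2 hA
  have := Gam_fi N
  have hfi : ((Gam N).subgroupOf AA).FiniteIndex := inferInstance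
  have h1 : Group.FG ((Gam N).subgroupOf AA) := Subgroup.fg_of_index_ne_zero _
  have h2 : ((Gam N).subgroupOf AA).FG := (Group.fg_iff_subgroup_fg _).1 h1
  have h3 : (((Gam N).subgroupOf AA).map AA.subtype).FG := sg_fg_map _ h2
  rw [Subgroup.subgroupOf_map_subtype, inf_comm] at h3
  exact (Group.fg_iff_subgroup_fg _).2 h3

def stE : Subgroup W where
  carrier := {g | rho g *ᵥ ee = ee}
  one_mem' := by simp
  mul_mem' := by
    intro a b ha hb
    simp only [Set.mem_ofPred_eq] at *
    rw [map_mul, ← mulVec_mulVec, hb, ha]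
  inv_mem' := by
    intro a ha
    simp only [Set.mem_ofPred_eq] at *
    conv_lhs => rw [← ha]
    exact rho_inv_mul a ee

theorem mem_stE {g : W} : g ∈ stE ↔ rho g *ᵥ ee = ee := Iff.rfl

noncomputable def CN (N : ℕ) : Subgroup W := AN N ⊓ stE

theorem ss_run (p : Q4) : rho ss *ᵥ vec p = vec (run [1,3,4,6] p) := run_spec _ _
theorem ss_inv : ss⁻¹ = cs.wordProd [6,4,3,1] := by
  rw [ss, ← cs.wordProd_reverse]; rfl
theorem ssi_run (p : Q4) : rho ss⁻¹ *ᵥ vec p = vec (run [6,4,3,1] p) := by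
  rw [ss_inv, run_spec]

theorem ss_e : ss ∈ stE := by
  show rho ss *ᵥ ee = ee
  rw [ee, ss_run]; congr 1

theorem conj_CN {N : ℕ} (g : W) (hg : g ∈ CN N) : ss * g * ss⁻¹ ∈ CN N :=
  ⟨⟨conj_AA g hg.1.1, Subgroup.Normal.conj_mem inferInstance g hg.1.2 ss⟩,
    stE.mul_mem (stE.mul_mem ss_e hg.2) (stE.inv_mem ss_e)⟩

theorem conj_CN' {N : ℕ} (g : W) (hg : g ∈ CN N) : ss⁻¹ * g * ss ∈ CN N := by
  have h := Subgroup.Normal.conj_mem (inferInstance : (Gam N).Normal) g hg.1.2 ss⁻¹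
  rw [inv_inv] at h
  exact ⟨⟨conj_AA' g hg.1.1, h⟩,
    stE.mul_mem (stE.mul_mem (stE.inv_mem ss_e) hg.2) ss_e⟩

theorem conj_CN_zpow {N : ℕ} (j : ℤ) : ∀ g ∈ CN N, ss ^ j * g * ss ^ (-j) ∈ CN N := by
  induction j using Int.induction_on with
  | zero => intro g hg; simpa using hg
  | succ i ih =>
    intro g hg
    have := conj_CN _ (ih g hg)
    convert this using 1
    group
  | pred i ih =>
    intro g hg
    have := conj_CN' _ (ih g hg)
    convert this using 1
    group

theorem c0_pow_xy (m : ℕ) : ∃ X Z : ℤ, 0 ≤ Z ∧ 0 < X ∧ X ^ 2 - 2 * Z ^ 2 = 1 ∧ (m ≠ 0 → 17 ≤ X) ∧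
    (∀ x y : ℤ, rho (c0 ^ m) *ᵥ vec (x,0,y,-y) = vec (X*x-2*Z*y,0,X*y-Z*x,-(X*y-Z*x))) ∧
    rho (c0 ^ m) *ᵥ ww = ww := by
  induction m with
  | zero => exact ⟨1, 0, by simp⟩
  | succ m ih =>
    obtain ⟨X, Z, h1, h2, h3, h4, h5, h6⟩ := ih
    refine ⟨17 * X + 24 * Z, 12 * X + 17 * Z, by linarith, by linarith, by nlinarith,
      fun _ => by linarith, fun x y => ?_, ?_⟩
    · rw [pow_succ', map_mul, ← mulVec_mulVec, h5, c0_xy]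
      congr 1
      ext <;> simp <;> ring
    · rw [pow_succ', map_mul, ← mulVec_mulVec, h6, c0_w]

theorem c0_pow_mem (N : ℕ) [NeZero N] : ∃ m : ℕ, m ≠ 0 ∧ c0 ^ m ∈ CN N := by
  have := Gam_fi N
  obtain ⟨m, hm, hm2⟩ := Subgroup.exists_pow_mem_of_index_ne_zero this.index_ne_zero c0
  refine ⟨m, by omega, ⟨AA.pow_mem c0_mem m, hm2.2⟩, stE.pow_mem (mem_stE.2 c0_e) m⟩

theorem vec_add (p q : Q4) : vec p + vec q = vec (p + q) := by
  ext a; fin_cases a <;> simp [vec]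

theorem sign_pos (m : ℕ) (hm : m ≠ 0) (y : Fin 4 → ℤ) (hy : Fwd y) :
    IP (rho ss *ᵥ ww) y + IP (rho (c0 ^ m) *ᵥ (rho ss *ᵥ ww)) y < 0 := by
  obtain ⟨X, Z, h1, h2, h3, h4, h5, h6⟩ := c0_pow_xy m
  have hX := h4 hm
  have hs : rho ss *ᵥ ww = (13 : ℤ) • ww + vec (36, 0, -12, -(-12)) := by
    rw [ww, ss_run]; decide +kernel
  have hc : rho (c0 ^ m) *ᵥ (rho ss *ᵥ ww) = (13 : ℤ) • ww + vec (X*36-2*Z*(-12),0,X*(-12)-Z*36,-(X*(-12)-Z*36)) := by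
    rw [hs, mulVec_add, h5, mulVec_smul, h6]
  rw [← IP_add, IP_comm]
  apply fwd_neg _ _ hy
  · rw [hc, hs]
    simp [IP, ww, vec]
    nlinarith
  · rw [hc, hs]
    simp [ww, vec]
    linarith

theorem sign_neg (m : ℕ) (hm : m ≠ 0) (y : Fin 4 → ℤ) (hy : Fwd y) :
    0 < IP (rho ss⁻¹ *ᵥ ww) y + IP (rho (c0 ^ m) *ᵥ (rho ss⁻¹ *ᵥ ww)) y := by
  obtain ⟨X, Z, h1, h2, h3, h4, h5, h6⟩ := c0_pow_xy m
  have hX := h4 hm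
  have hs : rho ss⁻¹ *ᵥ ww = (13 : ℤ) • ww + vec (-36, 0, -12, -(-12)) := by
    rw [ww, ssi_run]; decide +kernel
  have hc : rho (c0 ^ m) *ᵥ (rho ss⁻¹ *ᵥ ww) = (13 : ℤ) • ww + vec (X*(-36)-2*Z*(-12),0,X*(-12)-Z*(-36),-(X*(-12)-Z*(-36))) := by
    rw [hs, mulVec_add, h5, mulVec_smul, h6]
  have hZX : Z ≤ X := by nlinarith
  rw [← IP_add, IP_comm]
  have : IP y (-(rho ss⁻¹ *ᵥ ww + rho (c0 ^ m) *ᵥ (rho ss⁻¹ *ᵥ ww))) < 0 := by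
    apply fwd_neg _ _ hy
    · rw [hc, hs]
      simp [IP, ww, vec]
      nlinarith
    · rw [hc, hs]
      simp [ww, vec]
      linarith
  rw [← neg_one_smul ℤ, IP_smul_r] at this
  linarith

/-- value function -/
noncomputable def val (k : ℕ) (g : W) : ℤ := IP (rho (ss ^ k) *ᵥ ww) (rho g *ᵥ oo)

theorem val_conj (k : ℕ) (j : ℤ) (c : W) :
    val k (ss ^ (k - j) * c⁻¹ * ss ^ (-(k - j))) = IP (rho c *ᵥ (rho (ss ^ j) *ᵥ ww)) (rho (ss ^ (j - k)) *ᵥ oo) := by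
  rw [val, mulVec_mulVec, ← map_mul, rho_IP_inv, rho_IP_inv, mulVec_mulVec, mulVec_mulVec,
    ← map_mul, ← map_mul]
  have : (ss ^ k)⁻¹ * (ss ^ ((k : ℤ) - j) * c⁻¹ * ss ^ (-((k : ℤ) - j)))
      = (c * ss ^ j)⁻¹ * ss ^ (j - (k : ℤ)) := by
    group
  rw [this]

theorem val_one (k : ℕ) (j : ℤ) :
    val k 1 = IP ((rho (ss ^ j) *ᵥ ww)) (rho (ss ^ (j - k)) *ᵥ oo) := by
  have := val_conj k j 1
  rw [inv_one, mul_one, ← _root_.zpow_add, add_neg_cancel, zpow_zero] at this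
  rw [this]; simp

theorem val_signs (N : ℕ) [NeZero N] (k : ℕ) : (∃ g ∈ CN N, 0 < val k g) ∧ (∃ g ∈ CN N, ¬ 0 < val k g) := by
  obtain ⟨m, hm, hmem⟩ := c0_pow_mem N
  have hc := (CN N).inv_mem hmem
  constructor
  · have h := sign_neg m hm (rho (ss ^ ((-1 : ℤ) - k)) *ᵥ oo) (rho_fwd _ _ oo_fwd)
    rw [← _root_.zpow_neg_one, ← val_one, ← val_conj] at h
    by_cases h1 : 0 < val k 1
    · exact ⟨1, (CN N).one_mem, h1⟩
    · exact ⟨_, conj_CN_zpow (k - (-1)) _ hc, by linarith⟩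
  · have h := sign_pos m hm (rho (ss ^ ((1 : ℤ) - k)) *ᵥ oo) (rho_fwd _ _ oo_fwd)
    have e : (ss : W) = ss ^ (1 : ℤ) := by simp
    rw [e, ← _root_.zpow_mul, one_mul, ← val_one, ← val_conj] at h
    by_cases h1 : 0 < val k 1
    · exact ⟨_, conj_CN_zpow (k - 1) _ hc, by linarith⟩
    · exact ⟨1, (CN N).one_mem, h1⟩

theorem walk {G : Type*} [Group G] (S : Set G) (P : G → Prop) (u : G) (hu : u ∈ Subgroup.closure S) :
    ∀ g ∈ Subgroup.closure S, ((P g ∧ ¬ P (g * u)) ∨ (¬ P g ∧ P (g * u))) →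
      ∃ g ∈ Subgroup.closure S, ∃ c ∈ S ∪ S⁻¹, P g ∧ ¬ P (g * c) := by
  induction hu using Subgroup.closure_induction with
  | mem x hx =>
    rintro g hg (h | h)
    · exact ⟨g, hg, x, Or.inl hx, h.1, h.2⟩
    · exact ⟨g * x, Subgroup.mul_mem _ hg (Subgroup.subset_closure hx), x⁻¹, Or.inr (by simpa using hx),
        h.2, by simpa using h.1⟩
  | one => intro g hg h; simp at h
  | mul a b ha hb h1 h2 =>
    intro g hg h
    rw [← mul_assoc] at h
    have h1' := h1 g hg
    have h2' := h2 (g * a) (Subgroup.mul_mem _ hg ha)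
    clear h1 h2
    by_cases hga : P (g * a) <;> rcases h with ⟨h3, h4⟩ | ⟨h3, h4⟩
    · exact h2' (Or.inl ⟨hga, h4⟩)
    · exact h1' (Or.inr ⟨h3, hga⟩)
    · exact h1' (Or.inl ⟨h3, hga⟩)
    · exact h2' (Or.inr ⟨hga, h4⟩)
  | inv a ha h1 =>
    intro g hg h
    have := h1 (g * a⁻¹) (Subgroup.mul_mem _ hg (Subgroup.inv_mem _ ha))
    rw [inv_mul_cancel_right] at this
    exact this (h.symm.imp And.symm And.symm)

theorem fin_set (y : Fin 4 → ℤ) (hy : Fwd y) (hy1 : IP y y = -1) :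
    {x : Fin 4 → ℤ | IP x x = 6 ∧ 0 < IP x oo ∧ ¬ 0 < IP x y}.Finite := by
  apply (Set.finite_Icc (fun _ : Fin 4 => -(6 * y 0 ^ 2)) (fun _ => 6 * y 0 ^ 2)).subset
  rintro x ⟨h1, h2, h3⟩
  have hy0 := hy.2
  simp [IP, oo] at h1 h2 h3 hy1
  have hc : (x 1 * y 1 + x 2 * y 2 + x 3 * y 3) ^ 2 ≤
      (x 1 * x 1 + x 2 * x 2 + x 3 * x 3) * (y 1 * y 1 + y 2 * y 2 + y 3 * y 3) := by
    nlinarith [sq_nonneg (x 1 * y 2 - x 2 * y 1), sq_nonneg (x 1 * y 3 - x 3 * y 1),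
      sq_nonneg (x 2 * y 3 - x 3 * y 2)]
  have h4 : (x 0 * y 0) ^ 2 ≤ (x 1 * y 1 + x 2 * y 2 + x 3 * y 3) ^ 2 := by
    have h6 : 0 ≤ (-x 0) * y 0 := by apply mul_nonneg <;> linarith
    have h7 : 0 ≤ (x 0 * y 0 - (x 1 * y 1 + x 2 * y 2 + x 3 * y 3)) *
      (- (x 0 * y 0) - (x 1 * y 1 + x 2 * y 2 + x 3 * y 3)) := by
      apply mul_nonneg <;> linarith
    linarith
  have e1 : x 1 * x 1 + x 2 * x 2 + x 3 * x 3 = 6 + x 0 * x 0 := by linarith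
  have e2 : y 1 * y 1 + y 2 * y 2 + y 3 * y 3 = y 0 ^ 2 - 1 := by linarith
  rw [e1, e2] at hc
  have h5 : x 0 * x 0 ≤ 6 * y 0 ^ 2 - 6 := by nlinarith
  have key : ∀ t : ℤ, t * t ≤ 6 * y 0 ^ 2 → -(6 * y 0 ^ 2) ≤ t ∧ t ≤ 6 * y 0 ^ 2 := by
    intro t ht
    constructor <;> nlinarith
  have hk : ∀ a, x a * x a ≤ 6 * y 0 ^ 2 := by
    intro a
    fin_cases a <;> simp <;>
      nlinarith [mul_self_nonneg (x 1), mul_self_nonneg (x 2), mul_self_nonneg (x 3)]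
  exact ⟨fun a => (key _ (hk a)).1, fun a => (key _ (hk a)).2⟩

theorem CN_not_fg (N : ℕ) [NeZero N] : ¬ (CN N).FG := by
  rintro ⟨S, hS⟩
  have hex : ∀ k : ℕ, ∃ g ∈ CN N, ∃ c ∈ (S : Set W) ∪ (S : Set W)⁻¹, 0 < val k g ∧ ¬ 0 < val k (g * c) := by
    intro k
    obtain ⟨⟨g1, hg1, hp⟩, ⟨g2, hg2, hn⟩⟩ := val_signs N k
    rw [← hS] at hg1 hg2 ⊢
    exact walk (S : Set W) (fun g => 0 < val k g) (g1⁻¹ * g2)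
      (Subgroup.mul_mem _ (Subgroup.inv_mem _ hg1) hg2) g1 hg1 (Or.inl ⟨hp, by simpa using hn⟩)
  choose g hg c hc hp hn using hex
  have hfin : (⋃ c ∈ (S : Set W) ∪ (S : Set W)⁻¹, {x : Fin 4 → ℤ | IP x x = 6 ∧ 0 < IP x oo ∧ ¬ 0 < IP x (rho c *ᵥ oo)}).Finite := by
    apply Set.Finite.biUnion (S.finite_toSet.union S.finite_toSet.inv)
    intro c _
    apply fin_set _ (rho_fwd _ _ oo_fwd)
    rw [rho_IP]; simp [IP, oo]
  have hmem : ∀ k, rho ((g k)⁻¹ * ss ^ k) *ᵥ ww ∈ (⋃ c ∈ (S : Set W) ∪ (S : Set W)⁻¹, {x : Fin 4 → ℤ | IP x x = 6 ∧ 0 < IP x oo ∧ ¬ 0 < IP x (rho c *ᵥ oo)}) := by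
    intro k
    simp only [Set.mem_iUnion]
    refine ⟨c k, hc k, ?_, ?_, ?_⟩
    · rw [rho_IP]; simp [IP, ww, vec]
    · have := hp k
      rwa [val, ← rho_IP (g k)⁻¹, rho_inv_mul, mulVec_mulVec, ← map_mul] at this
    · have := hn k
      rwa [val, map_mul, ← mulVec_mulVec, ← rho_IP (g k)⁻¹, rho_inv_mul, mulVec_mulVec, ← map_mul] at this
  obtain ⟨k, l, hkl, heq⟩ : ∃ k l : ℕ, k ≠ l ∧ rho ((g k)⁻¹ * ss ^ k) *ᵥ ww = rho ((g l)⁻¹ * ss ^ l) *ᵥ ww := by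
    by_contra hcon
    push Not at hcon
    have hinj : Function.Injective (fun k : ℕ => rho ((g k)⁻¹ * ss ^ k) *ᵥ ww) := by
      intro a b hab
      by_contra h
      exact hcon a b h hab
    exact Set.infinite_of_injective_forall_mem hinj hmem hfin
  obtain ⟨t, ht, hTs⟩ := Tr_ss
  set h := ((g l)⁻¹ * ss ^ l)⁻¹ * ((g k)⁻¹ * ss ^ k) with hh
  have hse : ∀ k : ℕ, (g k)⁻¹ * ss ^ k ∈ stE := fun k =>
    stE.mul_mem (stE.inv_mem (hg k).2) (stE.pow_mem ss_e k)
  have hF : Fx h := by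
    constructor
    · exact stE.mul_mem (stE.inv_mem (hse l)) (hse k)
    · rw [hh, map_mul, ← mulVec_mulVec, heq, rho_inv_mul]
  have hT : ∀ k : ℕ, Tr ((g k)⁻¹ * ss ^ k) (k * t) := by
    intro k
    have := Tr_mul (Tr_inv (Tr_AA _ (hg k).1.1)) (Tr_pow hTs k)
    simpa using this
  have := stab_zero h _ hF (Tr_mul (Tr_inv (hT l)) (hT k))
  have h2 : ((k : ℤ) - l) * t = 0 := by linarith
  rcases mul_eq_zero.1 h2 with h3 | h3
  · apply hkl; omega
  · exact ht h3

end congr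
end Paper

namespace Paper
open Matrix

section geom

theorem aniso_aux (n : ℕ) : ∀ x u v : ℤ, x.natAbs = n → x ^ 2 = 2 * (u ^ 2 + u * v + v ^ 2) → x = 0 := by
  induction n using Nat.strong_induction_on with
  | _ n ih =>
    intro x u v hx h
    by_contra h0
    have hx2 : (2 : ℤ) ∣ x := by
      have : (2 : ℤ) ∣ x ^ 2 := ⟨_, h⟩
      exact Int.prime_two.dvd_of_dvd_pow this
    obtain ⟨y, rfl⟩ := hx2
    have h2 : 2 * y ^ 2 = u ^ 2 + u * v + v ^ 2 := by linarith
    have huv : (2 : ℤ) ∣ u ∧ (2 : ℤ) ∣ v := by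
      rcases Int.even_or_odd' u with ⟨a, rfl | rfl⟩ <;> rcases Int.even_or_odd' v with ⟨b, rfl | rfl⟩
      · exact ⟨⟨a, rfl⟩, ⟨b, rfl⟩⟩
      · exfalso; ring_nf at h2; omega
      · exfalso; ring_nf at h2; omega
      · exfalso; ring_nf at h2; omega
    obtain ⟨⟨a, rfl⟩, ⟨b, rfl⟩⟩ := huv
    have := ih y.natAbs (by omega) y a b rfl (by linarith)
    omega

theorem aniso (x : Fin 4 → ℤ) (h1 : IP x x = 0) (h2 : IP x ee = 0) : x = 0 := by
  simp [IP, ee, vec] at h1 h2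
  have h3 : x 3 = - x 1 - x 2 := by linarith
  rw [h3] at h1
  have h0 := aniso_aux _ (x 0) (x 1) (x 2) rfl (by linarith)
  rw [h0] at h1
  have e1 : x 1 = 0 := by
    by_contra h
    have : 0 < x 1 ^ 2 := by positivity
    nlinarith [sq_nonneg (x 1 + 2 * x 2)]
  have e2 : x 2 = 0 := by
    rw [e1] at h1
    have : x 2 * x 2 = 0 := by linarith
    simpa using this
  ext i
  fin_cases i <;> simp [h0, h3, e1, e2]

theorem ee_self : IP ee ee = 3 := by simp [IP, ee, vec]

theorem alpha_big (N K : ℕ) (hN : K + 3 ≤ N) (a : W) (ha : a ∈ Gam N) (hna : a ∉ stE) :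
    (K : ℤ) ≤ |IP (rho a *ᵥ ee) ee| := by
  set x := rho a *ᵥ ee - ee with hx
  have hxd : x = (rho a - 1) *ᵥ ee := by rw [sub_mulVec, one_mulVec]
  have hd : ∀ i, (N : ℤ) ∣ x i := by
    intro i
    rw [hxd, mulVec, dotProduct]
    exact Finset.dvd_sum fun j _ => Dvd.dvd.mul_right (mem_Gam.1 ha i j) _
  have hae : rho a *ᵥ ee = x + ee := by rw [hx]; simp
  have hd2 : (N : ℤ) ∣ IP x ee := by
    unfold IP
    exact dvd_add (dvd_add (dvd_add ((hd 0).mul_right _).neg_right ((hd 1).mul_right _))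
      ((hd 2).mul_right _)) ((hd 3).mul_right _)
  have hne : IP x ee ≠ 0 := by
    intro h0
    have h1 := rho_IP a ee ee
    rw [hae] at h1
    simp only [IP_add, IP_add_r, IP_comm ee x, h0] at h1
    have := aniso x (by linarith) h0
    exact hna (mem_stE.2 (by rw [hae, this, zero_add]))
  rw [hae, IP_add, ee_self]
  have h5 : (N : ℤ) ≤ |IP x ee| := Int.le_of_dvd (abs_pos.2 hne) ((dvd_abs _ _).2 hd2)
  have h6 : |IP x ee| ≤ |IP x ee + 3| + 3 := by
    calc |IP x ee| = |(IP x ee + 3) - 3| := by simp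
      _ ≤ |IP x ee + 3| + |(3:ℤ)| := abs_sub _ _
      _ = _ := by simp
  push_cast at *
  omega

/-- cast of an integer vector -/
def cq (x : Fin 4 → ℤ) : Fin 4 → ℚ := fun i => (x i : ℚ)

theorem cq_IP (x y : Fin 4 → ℤ) : IP (cq x) (cq y) = (IP x y : ℤ) := by simp [IP, cq]

noncomputable def rhoQ : W →* Matrix (Fin 4) (Fin 4) ℚ :=
  ((Int.castRingHom ℚ).mapMatrix.toMonoidHom).comp rho

theorem rhoQ_apply (g : W) (i j : Fin 4) : rhoQ g i j = (rho g i j : ℚ) := rfl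

theorem rhoQ_cq (g : W) (x : Fin 4 → ℤ) : rhoQ g *ᵥ cq x = cq (rho g *ᵥ x) := by
  ext i
  simp [mulVec, dotProduct, cq, rhoQ_apply]

theorem rhoQ_simple (i : Fin 8) (x : Fin 4 → ℚ) :
    rhoQ (cs.simple i) *ᵥ x = x - IP x (cq (al i)) • cq (al i) := by
  ext a
  simp only [rhoQ_apply, rho_simple, Rm, Matrix.mulVec, dotProduct, Fin.sum_univ_four, IP, Jd, Matrix.of_apply,
    Pi.sub_apply, Pi.smul_apply, smul_eq_mul, cq]
  fin_cases a <;> simp <;> ring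

theorem rhoQ_IP (g : W) (x y : Fin 4 → ℚ) : IP (rhoQ g *ᵥ x) (rhoQ g *ᵥ y) = IP x y := by
  induction g using cs.simple_induction_left with
  | one => simp
  | mul_simple_left w i ih =>
    rw [map_mul, ← mulVec_mulVec, ← mulVec_mulVec, ← ih, rhoQ_simple, rhoQ_simple]
    simp only [IP_sub, IP_sub_r, IP_smul, IP_smul_r, cq_IP, al_self, IP_comm (cq (al i)) _]
    push_cast
    ring

theorem rhoQ_inv_mul (g : W) (x : Fin 4 → ℚ) : rhoQ g⁻¹ *ᵥ (rhoQ g *ᵥ x) = x := by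
  rw [mulVec_mulVec, ← map_mul]; simp

theorem rhoQ_mul_inv (g : W) (x : Fin 4 → ℚ) : rhoQ g *ᵥ (rhoQ g⁻¹ *ᵥ x) = x := by
  rw [mulVec_mulVec, ← map_mul]; simp

theorem rhoQ_faithful (g : W) (h : rhoQ g = 1) : g = 1 := by
  apply rho_faithful
  ext i j
  have := congrFun (congrFun h i) j
  rw [rhoQ_apply, Matrix.one_apply] at this
  rw [Matrix.one_apply]
  split_ifs at * <;> exact_mod_cast this

variable {V : Type*} [AddCommGroup V] [Module ℚ V]

noncomputable def actV (V : Type*) [AddCommGroup V] [Module ℚ V] :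
    W →* (((Fin 4 → ℚ) × V) ≃ₗ[ℚ] ((Fin 4 → ℚ) × V)) where
  toFun g :=
    { toFun := fun z => (rhoQ g *ᵥ z.1, z.2)
      invFun := fun z => (rhoQ g⁻¹ *ᵥ z.1, z.2)
      map_add' := fun x y => by simp [mulVec_add]
      map_smul' := fun c x => by simp [mulVec_smul]
      left_inv := fun z => by simp only [rhoQ_inv_mul]
      right_inv := fun z => by simp only [rhoQ_mul_inv] }
  map_one' := by
    ext z <;> simp
  map_mul' a b := by
    apply LinearEquiv.ext
    intro z
    show (rhoQ (a * b) *ᵥ z.1, z.2) = (rhoQ a *ᵥ (rhoQ b *ᵥ z.1), z.2)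
    rw [map_mul, mulVec_mulVec]

theorem actV_apply (g : W) (z : (Fin 4 → ℚ) × V) : actV V g z = (rhoQ g *ᵥ z.1, z.2) := rfl

def eq' : Fin 4 → ℚ := cq ee
theorem eq'_self : IP eq' eq' = 3 := by rw [eq', cq_IP, ee_self]; norm_num

def QB (B : V →ₗ[ℚ] V →ₗ[ℚ] ℚ) (z : (Fin 4 → ℚ) × V) : ℚ := IP z.1 z.1 + B z.2 z.2

noncomputable def tauF (B : V →ₗ[ℚ] V →ₗ[ℚ] ℚ) (y0 : V) :
    ((Fin 4 → ℚ) × V) →ₗ[ℚ] ((Fin 4 → ℚ) × V) where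
  toFun z := z - (2 / (3 + B y0 y0) * (IP z.1 eq' + B z.2 y0)) • (eq', y0)
  map_add' x y := by
    simp only [Prod.fst_add, Prod.snd_add, IP_add, map_add, LinearMap.add_apply]
    module
  map_smul' c x := by
    simp only [Prod.smul_fst, Prod.smul_snd, IP_smul, map_smul, LinearMap.smul_apply, smul_eq_mul,
      RingHom.id_apply]
    module

theorem tauF_apply (B : V →ₗ[ℚ] V →ₗ[ℚ] ℚ) (y0 : V) (z : (Fin 4 → ℚ) × V) :
    tauF B y0 z = z - (2 / (3 + B y0 y0) * (IP z.1 eq' + B z.2 y0)) • (eq', y0) := rfl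

theorem tau_p (B : V →ₗ[ℚ] V →ₗ[ℚ] ℚ) (y0 : V) (h0 : 0 < B y0 y0) (z : (Fin 4 → ℚ) × V) :
    (3 + B y0 y0) * IP (tauF B y0 z).1 eq' = (B y0 y0 - 3) * IP z.1 eq' - 6 * B z.2 y0 := by
  rw [tauF_apply]
  simp only [Prod.fst_sub, Prod.smul_fst, IP_sub, IP_smul, eq'_self]
  field_simp
  ring

theorem tau_r (B : V →ₗ[ℚ] V →ₗ[ℚ] ℚ) (y0 : V) (h0 : 0 < B y0 y0) (z : (Fin 4 → ℚ) × V) :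
    (3 + B y0 y0) * B (tauF B y0 z).2 y0 = (3 - B y0 y0) * B z.2 y0 - 2 * B y0 y0 * IP z.1 eq' := by
  rw [tauF_apply]
  simp only [Prod.snd_sub, Prod.smul_snd, map_sub, map_smul, LinearMap.sub_apply,
    LinearMap.smul_apply, smul_eq_mul]
  field_simp
  ring

theorem tau_Q (B : V →ₗ[ℚ] V →ₗ[ℚ] ℚ) (hs : ∀ x y, B x y = B y x) (y0 : V) (h0 : 0 < B y0 y0)
    (z : (Fin 4 → ℚ) × V) : QB B (tauF B y0 z) = QB B z := by
  rw [tauF_apply]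
  simp only [QB, Prod.snd_sub, Prod.smul_snd, Prod.fst_sub, Prod.smul_fst, map_sub, map_smul,
    LinearMap.sub_apply, LinearMap.smul_apply, smul_eq_mul, IP_sub, IP_smul, IP_sub_r, IP_smul_r,
    eq'_self, IP_comm eq' z.1, hs y0 z.2]
  field_simp
  ring

theorem tau_inv (B : V →ₗ[ℚ] V →ₗ[ℚ] ℚ) (y0 : V) (h0 : 0 < B y0 y0) :
    Function.Involutive (tauF B y0) := by
  intro z
  have h1 := tau_p B y0 h0 z
  have h2 := tau_r B y0 h0 z
  have h3 : IP (tauF B y0 z).1 eq' + B (tauF B y0 z).2 y0 = -(IP z.1 eq' + B z.2 y0) := by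
    have h4 : (3 + B y0 y0) ≠ 0 := by positivity
    apply mul_left_cancel₀ h4
    rw [mul_add, h1, h2]; ring
  rw [tauF_apply _ _ (tauF B y0 z), h3, tauF_apply]
  module

noncomputable def tau (B : V →ₗ[ℚ] V →ₗ[ℚ] ℚ) (y0 : V) (h0 : 0 < B y0 y0) :
    ((Fin 4 → ℚ) × V) ≃ₗ[ℚ] ((Fin 4 → ℚ) × V) :=
  LinearEquiv.ofInvolutive (tauF B y0) (tau_inv B y0 h0)

theorem tau_apply (B : V →ₗ[ℚ] V →ₗ[ℚ] ℚ) (y0 : V) (h0 : 0 < B y0 y0) (z : (Fin 4 → ℚ) × V) :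
    tau B y0 h0 z = tauF B y0 z := rfl
theorem tau_inv_apply (B : V →ₗ[ℚ] V →ₗ[ℚ] ℚ) (y0 : V) (h0 : 0 < B y0 y0) (z : (Fin 4 → ℚ) × V) :
    (tau B y0 h0)⁻¹ z = tauF B y0 z := rfl

theorem csB (B : V →ₗ[ℚ] V →ₗ[ℚ] ℚ) (hs : ∀ x y, B x y = B y x) (hp : ∀ y, 0 ≤ B y y)
    (y0 : V) (h0 : 0 < B y0 y0) (y : V) : B y y0 ^ 2 ≤ B y0 y0 * B y y := by
  have := hp (B y0 y0 • y - B y y0 • y0)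
  simp only [map_sub, map_smul, LinearMap.sub_apply, LinearMap.smul_apply, smul_eq_mul, hs y0 y] at this
  have h2 : 0 ≤ B y0 y0 * (B y0 y0 * B y y - B y y0 ^ 2) := by linarith
  have := nonneg_of_mul_nonneg_right h2 h0
  linarith

theorem pp_num (z1 f : Fin 4 → ℚ) (h M r b : ℚ) (hh : 0 < h) (hM : 0 ≤ M) (hQ : IP z1 z1 + b < 0)
    (hb : r ^ 2 ≤ h * b) (hp : |IP z1 eq'| ≤ M * |r|) (hf : IP f f = 3)
    (hα : 2 * (h * M ^ 2) + 9 ≤ |IP f eq'|) : M * |r| < |IP z1 f| := by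
  set p := IP z1 eq' with hpd
  set α := IP f eq' with hαd
  set P := IP z1 f with hPd
  by_contra hcon
  push Not at hcon
  have hzL : IP (z1 - (p / 3) • eq') (z1 - (p / 3) • eq') = IP z1 z1 - p ^ 2 / 3 := by
    simp only [IP_sub, IP_smul, IP_sub_r, IP_smul_r, eq'_self, IP_comm eq' z1, ← hpd]
    ring
  have hfL : IP (f - (α / 3) • eq') (f - (α / 3) • eq') = 3 - α ^ 2 / 3 := by
    simp only [IP_sub, IP_smul, IP_sub_r, IP_smul_r, eq'_self, IP_comm eq' f, ← hαd, hf]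
    ring
  have hzf : IP (z1 - (p / 3) • eq') (f - (α / 3) • eq') = P - α * p / 3 := by
    simp only [IP_sub, IP_smul, IP_sub_r, IP_smul_r, eq'_self, IP_comm eq' f, ← hαd, ← hpd, ← hPd]
    ring
  have hb' : r ^ 2 / h ≤ b := by rw [div_le_iff₀ hh]; linarith
  have hrh : 0 ≤ r ^ 2 / h := by positivity
  have hneg : IP z1 z1 - p ^ 2 / 3 < -(r ^ 2 / h + p ^ 2 / 3) := by linarith
  have hR := rcs (z1 - (p / 3) • eq') (f - (α / 3) • eq') (by rw [hzL]; nlinarith [sq_nonneg p])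
  rw [hzL, hfL, hzf] at hR
  have hc : 0 ≤ h * M ^ 2 := by positivity
  have hα2 : 2 * (h * M ^ 2) * |α| + 9 * (2 * (h * M ^ 2) + 9) ≤ α ^ 2 := by
    rw [← sq_abs α]; nlinarith
  have hpos : 0 < α ^ 2 / 3 - 3 := by nlinarith [abs_nonneg α, mul_nonneg hc (abs_nonneg α)]
  have h1 : (r ^ 2 / h + p ^ 2 / 3) * (α ^ 2 / 3 - 3) < (P - α * p / 3) ^ 2 := by
    have := mul_lt_mul_of_pos_right hneg hpos
    nlinarith
  have hp2 : p ^ 2 ≤ M ^ 2 * r ^ 2 := by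
    rw [← sq_abs p, ← sq_abs r, ← mul_pow]; exact pow_le_pow_left₀ (abs_nonneg _) hp 2
  have hP2 : P ^ 2 ≤ M ^ 2 * r ^ 2 := by
    rw [← sq_abs P, ← sq_abs r, ← mul_pow]; exact pow_le_pow_left₀ (abs_nonneg _) hcon 2
  have hpP : |α * p * P| ≤ |α| * (M ^ 2 * r ^ 2) := by
    rw [abs_mul, abs_mul, mul_assoc]
    apply mul_le_mul_of_nonneg_left _ (abs_nonneg _)
    rw [← sq_abs r, ← mul_pow, sq]
    exact mul_le_mul hp hcon (abs_nonneg _) (by positivity)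
  have hpP' := neg_le_of_abs_le hpP
  have h2 : r ^ 2 / h * (α ^ 2 / 3 - 3) < M ^ 2 * r ^ 2 * (2 + 2 / 3 * |α|) := by nlinarith
  have h3 : r ^ 2 * (α ^ 2 / 3 - 3) < h * (M ^ 2 * r ^ 2 * (2 + 2 / 3 * |α|)) := by
    have := mul_lt_mul_of_pos_left h2 hh
    have e : h * (r ^ 2 / h * (α ^ 2 / 3 - 3)) = r ^ 2 * (α ^ 2 / 3 - 3) := by field_simp
    linarith
  have h4 : h * (M ^ 2) * (2 + 2 / 3 * |α|) ≤ α ^ 2 / 3 - 3 := by linarith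
  nlinarith [mul_le_mul_of_nonneg_left h4 (sq_nonneg r)]

theorem disj_num (h p r p' r' M : ℚ) (hh : 0 < h) (hM : h * M = h + 6)
    (h1 : (3 + h) * p' = (h - 3) * p - 6 * r) (h2 : (3 + h) * r' = (3 - h) * r - 2 * h * p)
    (h3 : M * |r| < |p|) (h4 : M * |r'| < |p'|) : False := by
  have hM1 : 1 ≤ M := by
    by_contra hc
    push Not at hc
    nlinarith
  have hr : |r| ≤ |p| := by nlinarith [abs_nonneg r]
  have h3h : 0 < 3 + h := by linarith
  have a1 : (3 + h) * |p'| ≤ |h - 3| * |p| + 6 * |r| := by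
    calc (3 + h) * |p'| = |(3 + h) * p'| := by rw [abs_mul, abs_of_pos h3h]
      _ = |(h - 3) * p - 6 * r| := by rw [h1]
      _ ≤ |(h - 3) * p| + |6 * r| := abs_sub _ _
      _ = _ := by rw [abs_mul, abs_mul]; norm_num
  have a2 : 2 * h * |p| ≤ (3 + h) * |r'| + |h - 3| * |r| := by
    have e : 2 * h * p = (3 - h) * r - (3 + h) * r' := by linarith
    calc 2 * h * |p| = |2 * h * p| := by rw [abs_mul, abs_of_pos (by linarith : 0 < 2 * h)]
      _ = |(3 - h) * r - (3 + h) * r'| := by rw [e]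
      _ ≤ |(3 - h) * r| + |(3 + h) * r'| := abs_sub _ _
      _ = _ := by rw [abs_mul, abs_mul, abs_of_pos h3h, abs_sub_comm 3 h]; ring
  have a3 : M * ((3 + h) * |r'|) < (3 + h) * |p'| := by nlinarith
  have a4 : M * (2 * h * |p|) ≤ M * ((3 + h) * |r'| + |h - 3| * |r|) :=
    mul_le_mul_of_nonneg_left a2 (by linarith)
  have a5 : |h - 3| * (M * |r|) ≤ |h - 3| * |p| := mul_le_mul_of_nonneg_left h3.le (abs_nonneg _)
  have a6 : |h - 3| ≤ h + 3 := by rw [abs_le]; constructor <;> linarith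
  have a7 : M * (2 * h * |p|) = 2 * (h + 6) * |p| := by rw [← hM]; ring
  have a8 := mul_le_mul_of_nonneg_right a6 (abs_nonneg p)
  nlinarith [abs_nonneg p, abs_nonneg r]

end geom
end Paper

namespace Paper
open Matrix

section geom2
variable {V : Type*} [AddCommGroup V] [Module ℚ V]

theorem actV_Q (B : V →ₗ[ℚ] V →ₗ[ℚ] ℚ) (a : W) (z : (Fin 4 → ℚ) × V) :
    QB B (actV V a z) = QB B z := by
  rw [actV_apply, QB, QB, rhoQ_IP]

theorem stE_eq {c : W} (hc : c ∈ stE) : rhoQ c *ᵥ eq' = eq' := by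
  rw [eq', rhoQ_cq, mem_stE.1 hc]

theorem actV_p {c : W} (hc : c ∈ stE) (z : (Fin 4 → ℚ) × V) :
    IP (actV V c z).1 eq' = IP z.1 eq' := by
  rw [actV_apply]
  conv_lhs => rw [← stE_eq hc]
  rw [rhoQ_IP]

theorem tau_comm (B : V →ₗ[ℚ] V →ₗ[ℚ] ℚ) (y0 : V) {c : W} (hc : c ∈ stE) (z : (Fin 4 → ℚ) × V) :
    tauF B y0 (actV V c z) = actV V c (tauF B y0 z) := by
  have h1 := actV_p hc z
  have h2 : actV V c (eq', y0) = (eq', y0) := by rw [actV_apply, stE_eq hc]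
  rw [tauF_apply, tauF_apply, h1, map_sub, map_smul, h2]
  rfl

theorem geom_main (B : V →ₗ[ℚ] V →ₗ[ℚ] ℚ) (hs : ∀ x y, B x y = B y x) (hp : ∀ y, 0 ≤ B y y)
    (y0 : V) (h0 : 0 < B y0 y0) :
    ∃ K : ℕ, ∀ N : ℕ, N ≠ 0 → K ≤ N →
      ∃ H : Subgroup (((Fin 4 → ℚ) × V) ≃ₗ[ℚ] ((Fin 4 → ℚ) × V)), Group.FG H ∧
        ¬ IsFinitelyPresented H ∧ ∀ L : Subgroup (((Fin 4 → ℚ) × V) ≃ₗ[ℚ] ((Fin 4 → ℚ) × V)),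
          (∀ a ∈ Gam N, actV V a ∈ L ∧ tau B y0 h0 * actV V a * (tau B y0 h0)⁻¹ ∈ L) → H ≤ L := by
  set h := B y0 y0 with hh
  set M : ℚ := (h + 6) / h with hMd
  have hM : h * M = h + 6 := by rw [hMd]; field_simp
  have hM0 : 0 < M := by positivity
  obtain ⟨K, hK⟩ := exists_nat_ge (2 * (h * M ^ 2) + 9)
  refine ⟨K + 3, fun N hN0 hKN => ?_⟩
  have : NeZero N := ⟨hN0⟩
  set τ := tau B y0 h0 with hτ
  set C : Subgroup (AN N) := stE.subgroupOf (AN N) with hCd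
  have hC : ¬ C.FG := by
    intro hC
    have := sg_fg_map (AN N).subtype hC
    rw [hCd, Subgroup.subgroupOf_map_subtype, inf_comm] at this
    exact CN_not_fg N this
  set ft : AN N →* (((Fin 4 → ℚ) × V) ≃ₗ[ℚ] ((Fin 4 → ℚ) × V)) := (actV V).comp (AN N).subtype with hft
  set ff : AN N →* (((Fin 4 → ℚ) × V) ≃ₗ[ℚ] ((Fin 4 → ℚ) × V)) :=
    (MulAut.conj τ).toMonoidHom.comp ft with hff
  have ft_a : ∀ (a : AN N) z, ft a z = actV V (a : W) z := fun _ _ => rfl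
  have ff_a : ∀ (a : AN N) z, ff a z = tauF B y0 (actV V (a : W) (tauF B y0 z)) := fun _ _ => rfl
  have hττ : ∀ z, tauF B y0 (tauF B y0 z) = z := tau_inv B y0 h0
  let Yt : Set ((Fin 4 → ℚ) × V) := {z | QB B z < 0 ∧ M * |B z.2 y0| < |IP z.1 eq'|}
  let Yf : Set ((Fin 4 → ℚ) × V) := {z | tauF B y0 z ∈ Yt}
  let x0 : (Fin 4 → ℚ) × V := (cq oo, 0)
  have hx0 : QB B x0 < 0 := by simp [QB, x0, IP, cq, oo]
  have hx0p : IP x0.1 eq' = 0 := by simp [x0, IP, cq, oo, eq', ee, vec]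
  have hx0r : B x0.2 y0 = 0 := by simp [x0]
  have hYt0 : ∀ z : (Fin 4 → ℚ) × V, IP z.1 eq' = 0 → z ∉ Yt := by
    rintro z hz ⟨_, h2⟩
    rw [hz, abs_zero] at h2
    have : 0 ≤ M * |B z.2 y0| := by positivity
    linarith
  have hYf0 : ∀ z : (Fin 4 → ℚ) × V, IP z.1 eq' = 0 → B z.2 y0 = 0 → z ∉ Yf := by
    intro z hz hz2
    apply hYt0
    have := tau_p B y0 h0 z
    rw [hz, hz2] at this
    have h3 : (3 + B y0 y0) ≠ 0 := by positivity
    apply mul_left_cancel₀ h3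
    rw [this]; ring
  have hYn : ∀ z : (Fin 4 → ℚ) × V, IP z.1 eq' = 0 → B z.2 y0 = 0 → ∀ i : Bool, z ∉ (if i then Yt else Yf) := by
    intro z h1 h2 i
    cases i
    · exact hYf0 z h1 h2
    · exact hYt0 z h1
  have hpt : ∀ a : AN N, a ∉ C → ∀ z, QB B z < 0 → z ∉ Yt → ft a z ∈ Yt := by
    intro a ha z hz hzY
    rw [ft_a]
    refine ⟨by rw [actV_Q]; exact hz, ?_⟩
    have ha' : (a : W) ∉ stE := fun h => ha (Subgroup.mem_subgroupOf.2 h)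
    have hf : IP (rhoQ (a : W)⁻¹ *ᵥ eq') (rhoQ (a : W)⁻¹ *ᵥ eq') = 3 := by rw [rhoQ_IP, eq'_self]
    have hα : 2 * (h * M ^ 2) + 9 ≤ |IP (rhoQ (a : W)⁻¹ *ᵥ eq') eq'| := by
      have := alpha_big N K hKN (a : W)⁻¹ ((Gam N).inv_mem a.2.2) (fun h => ha' (by simpa using stE.inv_mem h))
      refine hK.trans ?_
      rw [eq', rhoQ_cq, cq_IP]
      exact_mod_cast this
    have := pp_num z.1 _ h M (B z.2 y0) (B z.2 z.2) h0 hM0.le hz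
      (csB B hs hp y0 h0 _) (by
        by_contra hc
        push Not at hc
        exact hzY ⟨hz, hc⟩) hf hα
    rw [actV_apply]
    simp only
    rwa [← rhoQ_IP (a : W), rhoQ_mul_inv] at this
  obtain ⟨H, hH1, hH2, hH3⟩ := amalgam_main (AN_fg N) C hC (fun i => if i then ft else ff) (by
      intro c _ hc1
      have : actV V (c : W) = 1 := hc1
      apply Subtype.ext
      apply rhoQ_faithful
      apply Matrix.ext_of_mulVec_single
      intro i
      have := congrArg (fun g => (g (Pi.single i 1, 0)).1) this
      simp only [actV_apply] at this
      rw [this, one_mulVec]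
      rfl) (by
      intro c hc
      apply LinearEquiv.ext
      intro z
      show ff c z = ft c z
      rw [ff_a, ft_a, ← tau_comm B y0 (Subgroup.mem_subgroupOf.1 hc), hττ])
    {z | QB B z < 0} (fun i => if i then Yt else Yf) (by
      intro i z hz
      cases i
      · have hz : QB B (tauF B y0 z) < 0 := hz.1
        rwa [tau_Q B hs y0 h0] at hz
      · exact hz.1) (by
      intro z h1 h2
      have h1 : z ∈ Yt := h1
      have h2 : tauF B y0 z ∈ Yt := h2
      exact disj_num h _ _ _ _ M h0 hM (tau_p B y0 h0 z) (tau_r B y0 h0 z) h1.2 h2.2)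
    x0 hx0 (hYn _ hx0p hx0r) (by
      intro c hc
      have hc := Subgroup.mem_subgroupOf.1 hc
      refine ⟨?_, hYn _ ?_ hx0r⟩
      · show QB B (actV V (c : W) x0) < 0
        rw [actV_Q]; exact hx0
      · show IP (actV V (c : W) x0).1 eq' = 0
        rw [actV_p hc]; exact hx0p) (by
      intro c hc i z hz
      have hc := Subgroup.mem_subgroupOf.1 hc
      have hpt' : ∀ z ∈ Yt, actV V (c : W) z ∈ Yt := by
        rintro z ⟨h1, h2⟩
        refine ⟨by rw [actV_Q]; exact h1, ?_⟩
        rw [actV_p hc]; exact h2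
      cases i
      · show tauF B y0 (actV V (c : W) z) ∈ Yt
        rw [tau_comm B y0 hc]
        exact hpt' _ hz
      · exact hpt' _ hz) (by
      intro i a ha z hz hzY
      cases i
      · show tauF B y0 (ff a z) ∈ Yt
        rw [ff_a, hττ]
        exact hpt a ha _ (by rw [tau_Q B hs y0 h0]; exact hz) hzY
      · exact hpt a ha z hz hzY)
  refine ⟨H, hH1, hH2, fun L hL => hH3 L ?_⟩
  intro i a
  cases i
  · exact (hL a a.2.2).2
  · exact (hL a a.2.2).1

end geom2
end Paper

namespace Paper
open Matrix

section fin1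

theorem qeval_comb {m : ℕ} {R : Type*} [CommRing R] (Q : Matrix (Fin m) (Fin m) R) (x y : Fin m → R)
    (s t : R) : qeval Q (s • x + t • y) = s ^ 2 * qeval Q x + s * t * (x ⬝ᵥ (Q *ᵥ y) + y ⬝ᵥ (Q *ᵥ x))
      + t ^ 2 * qeval Q y := by
  simp only [qeval, mulVec_add, mulVec_smul, add_dotProduct, dotProduct_add, smul_dotProduct,
    dotProduct_smul, smul_eq_mul]
  ring

theorem dot_cast {m : ℕ} (Q : Matrix (Fin m) (Fin m) ℚ) (x y : Fin m → ℚ) :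
    (fun i => ((x i : ℚ) : ℝ)) ⬝ᵥ (Q.map (Rat.cast : ℚ → ℝ) *ᵥ (fun i => ((y i : ℚ) : ℝ)))
      = ((x ⬝ᵥ (Q *ᵥ y) : ℚ) : ℝ) := by
  simp [dotProduct, mulVec]

theorem posdef {n : ℕ} (F : Matrix (Fin (n + 1)) (Fin (n + 1)) ℚ) (hsig : HasSignature F n 1)
    (u v : Fin (n + 1) → ℚ) (hu : qeval F u < 0) (huv : qeval F (u + v) = qeval F u + qeval F v)
    (hv : v ≠ 0) : 0 < qeval F v := by
  obtain ⟨_, T, hT, hG⟩ := hsig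
  by_contra hcon
  push Not at hcon
  have hTu : IsUnit T.det := isUnit_iff_ne_zero.2 hT
  set uR : Fin (n + 1) → ℝ := fun i => (u i : ℝ) with huR
  set vR : Fin (n + 1) → ℝ := fun i => (v i : ℝ) with hvR
  set x := T⁻¹ *ᵥ uR with hx
  set y := T⁻¹ *ᵥ vR with hy
  have hTx : T *ᵥ x = uR := by rw [hx, mulVec_mulVec, Matrix.mul_nonsing_inv _ hTu, one_mulVec]
  have hTy : T *ᵥ y = vR := by rw [hy, mulVec_mulVec, Matrix.mul_nonsing_inv _ hTu, one_mulVec]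
  have hcross : u ⬝ᵥ (F *ᵥ v) + v ⬝ᵥ (F *ᵥ u) = 0 := by
    have := qeval_comb F u v 1 1
    simp only [one_smul] at this
    linarith
  have hq : ∀ s t : ℝ, qeval (F.map (Rat.cast : ℚ → ℝ)) (s • uR + t • vR) =
      s ^ 2 * (qeval F u : ℚ) + t ^ 2 * (qeval F v : ℚ) := by
    intro s t
    rw [qeval_comb, qeval, qeval, huR, hvR, dot_cast, dot_cast, dot_cast, dot_cast, ← Rat.cast_add, hcross]
    simp [qeval]
  have hS : ∀ s t : ℝ, (∑ i : Fin n, (s * x i.castSucc + t * y i.castSucc) ^ 2)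
      - (s * x (Fin.last n) + t * y (Fin.last n)) ^ 2 =
      s ^ 2 * (qeval F u : ℚ) + t ^ 2 * (qeval F v : ℚ) := by
    intro s t
    rw [← hq, ← hTx, ← hTy, ← mulVec_smul T s x, ← mulVec_smul T t y, ← mulVec_add, hG, Fin.sum_univ_castSucc]
    simp [sub_eq_add_neg]
  have hu' : ((qeval F u : ℚ) : ℝ) < 0 := by exact_mod_cast hu
  have hv' : ((qeval F v : ℚ) : ℝ) ≤ 0 := by exact_mod_cast hcon
  by_cases hl : y (Fin.last n) = 0
  · have h1 := hS 0 1
    rw [hl] at h1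
    simp only [zero_mul, one_mul, zero_add] at h1
    have h2 : ∑ i : Fin n, (y i.castSucc) ^ 2 = 0 := by
      apply le_antisymm _ (Finset.sum_nonneg fun i _ => sq_nonneg _)
      nlinarith
    rw [Finset.sum_eq_zero_iff_of_nonneg (fun i _ => sq_nonneg _)] at h2
    have hy0 : y = 0 := by
      ext i
      refine Fin.lastCases ?_ (fun i => ?_) i
      · exact hl
      · exact pow_eq_zero_iff (two_ne_zero) |>.1 (h2 i (Finset.mem_univ _))
    rw [hy0, mulVec_zero] at hTy
    apply hv
    ext i
    have := congrFun hTy i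
    simp only [hvR, Pi.zero_apply] at this
    exact_mod_cast this.symm
  · have h1 := hS (y (Fin.last n)) (-x (Fin.last n))
    have h2 : 0 ≤ ∑ i : Fin n, (y (Fin.last n) * x i.castSucc + -x (Fin.last n) * y i.castSucc) ^ 2 :=
      Finset.sum_nonneg fun i _ => sq_nonneg _
    have h3 : 0 < (y (Fin.last n)) ^ 2 := by positivity
    have h4 : y (Fin.last n) * x (Fin.last n) + -x (Fin.last n) * y (Fin.last n) = 0 := by ring
    rw [h4] at h1
    nlinarith [mul_neg_of_pos_of_neg h3 hu', mul_nonneg (sq_nonneg (-x (Fin.last n))) (neg_nonneg.2 hv')]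

noncomputable def BH {m : ℕ} (H : Matrix (Fin m) (Fin m) ℚ) :
    (Fin m → ℚ) →ₗ[ℚ] (Fin m → ℚ) →ₗ[ℚ] ℚ :=
  LinearMap.mk₂ ℚ (fun y z => (y ⬝ᵥ (H *ᵥ z) + z ⬝ᵥ (H *ᵥ y)) / 2)
    (fun a b c => by simp only [mulVec_add, add_dotProduct, dotProduct_add]; ring)
    (fun a b c => by simp only [mulVec_smul, smul_dotProduct, dotProduct_smul, smul_eq_mul]; ring)
    (fun a b c => by simp only [mulVec_add, add_dotProduct, dotProduct_add]; ring)
    (fun a b c => by simp only [mulVec_smul, smul_dotProduct, dotProduct_smul, smul_eq_mul]; ring)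

theorem BH_symm {m : ℕ} (H : Matrix (Fin m) (Fin m) ℚ) (x y) : BH H x y = BH H y x := by
  simp [BH, add_comm]

theorem BH_self {m : ℕ} (H : Matrix (Fin m) (Fin m) ℚ) (x) : BH H x x = qeval H x := by
  simp [BH, qeval]

theorem qeval_q3 (x : Fin 4 → ℚ) : qeval q3 x = IP x x := by
  simp [qeval, q3, IP, dotProduct, Fin.sum_univ_four, mulVec_diagonal]

noncomputable def Psi {k m : ℕ} (hm : k = 4 + m) (T : Matrix (Fin k) (Fin k) ℚ) (hT : T.det ≠ 0) :
    ((Fin 4 → ℚ) × (Fin m → ℚ)) ≃ₗ[ℚ] (Fin k → ℚ) where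
  toFun z := T *ᵥ (Fin.append z.1 z.2 ∘ Fin.cast hm)
  map_add' x y := by
    rw [← mulVec_add]
    congr 1
    ext i
    simp only [Function.comp, Pi.add_apply, Prod.fst_add, Prod.snd_add]
    refine Fin.addCases (fun j => ?_) (fun j => ?_) (Fin.cast hm i) <;> simp
  map_smul' c x := by
    rw [RingHom.id_apply, ← mulVec_smul]
    congr 1
    ext i
    simp only [Function.comp, Pi.smul_apply, Prod.smul_fst, Prod.smul_snd]
    refine Fin.addCases (fun j => ?_) (fun j => ?_) (Fin.cast hm i) <;> simp
  invFun v := (fun i => (T⁻¹ *ᵥ v) (Fin.cast hm.symm (Fin.castAdd m i)),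
    fun i => (T⁻¹ *ᵥ v) (Fin.cast hm.symm (Fin.natAdd 4 i)))
  left_inv z := by
    have hTu : IsUnit T.det := isUnit_iff_ne_zero.2 hT
    simp only [mulVec_mulVec, Matrix.nonsing_inv_mul _ hTu, one_mulVec]
    ext i <;> simp
  right_inv v := by
    have hTu : IsUnit T.det := isUnit_iff_ne_zero.2 hT
    have : ∀ w : Fin k → ℚ, (Fin.append (fun i => w (Fin.cast hm.symm (Fin.castAdd m i)))
      (fun i => w (Fin.cast hm.symm (Fin.natAdd 4 i))) ∘ Fin.cast hm) = w := by
      intro w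
      subst hm
      ext i
      simp only [Function.comp]
      refine Fin.addCases (fun j => ?_) (fun j => ?_) i <;> simp
    simp only [this]
    rw [mulVec_mulVec, Matrix.mul_nonsing_inv _ hTu, one_mulVec]

theorem Psi_apply {k m : ℕ} (hm : k = 4 + m) (T : Matrix (Fin k) (Fin k) ℚ) (hT : T.det ≠ 0) (z) :
    Psi hm T hT z = T *ᵥ (Fin.append z.1 z.2 ∘ Fin.cast hm) := rfl

end fin1

section fin2
variable {V : Type*} [AddCommGroup V] [Module ℚ V] {k : ℕ}

theorem integral (Ψ : ((Fin 4 → ℚ) × V) ≃ₗ[ℚ] (Fin k → ℚ)) :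
    ∃ N0 : ℕ, N0 ≠ 0 ∧ ∀ N, N0 ∣ N → ∀ a ∈ Gam N, ∃ A : Matrix (Fin k) (Fin k) ℤ, ∀ z,
      Ψ (actV V a z) = A.map (algebraMap ℤ ℚ) *ᵥ Ψ z := by
  let κ : Fin k → Fin k → Fin 4 → Fin 4 → ℚ := fun r c i j =>
    (Ψ.symm (Pi.single c 1)).1 j * Ψ (Pi.single i 1, 0) r
  refine ⟨∏ r, ∏ c, ∏ i, ∏ j, (κ r c i j).den, ?_, ?_⟩
  · simp only [Finset.prod_ne_zero_iff]
    intros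
    exact Rat.den_nz _
  intro N hN a ha
  have hκ : ∀ r c i j, ∃ t : ℤ, (N : ℚ) * κ r c i j = t := by
    intro r c i j
    have h1 : (κ r c i j).den ∣ N := by
      refine dvd_trans ?_ hN
      refine dvd_trans ?_ (Finset.dvd_prod_of_mem _ (Finset.mem_univ r))
      refine dvd_trans ?_ (Finset.dvd_prod_of_mem _ (Finset.mem_univ c))
      refine dvd_trans ?_ (Finset.dvd_prod_of_mem _ (Finset.mem_univ i))
      exact Finset.dvd_prod_of_mem (fun j => (κ r c i j).den) (Finset.mem_univ j)
    obtain ⟨d, hd⟩ := h1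
    refine ⟨d * (κ r c i j).num, ?_⟩
    rw [hd]
    push_cast
    rw [mul_comm ((κ r c i j).den : ℚ), mul_assoc, mul_comm ((κ r c i j).den : ℚ), Rat.mul_den_eq_num]
  choose t ht using hκ
  choose b hb using mem_Gam.1 ha
  refine ⟨1 + Matrix.of fun r c => ∑ i, ∑ j, b i j * t r c i j, ?_⟩
  have key : ∀ z, Ψ (actV V a z) = Ψ z + Ψ ((rhoQ a - 1) *ᵥ z.1, 0) := by
    intro z
    rw [← map_add, actV_apply]
    congr 1
    ext <;> simp [sub_mulVec]
  have hlin : Ψ.toLinearMap ∘ₗ (actV V a).toLinearMap ∘ₗ Ψ.symm.toLinearMap = Matrix.mulVecLin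
     ((1 + Matrix.of fun r c => ∑ i, ∑ j, b i j * t r c i j).map (algebraMap ℤ ℚ)) := by
    apply LinearMap.pi_ext'
    intro c
    apply LinearMap.ext_ring
    ext r
    simp only [LinearMap.comp_apply, LinearEquiv.coe_coe, LinearMap.coe_single, key,
      Matrix.mulVecLin_apply, mulVec_single_one, LinearEquiv.apply_symm_apply]
    set z := Ψ.symm (Pi.single c 1) with hz
    have e1 : (((rhoQ a - 1) *ᵥ z.1, 0) : (Fin 4 → ℚ) × V) =
        ∑ i, ((rhoQ a - 1) *ᵥ z.1) i • ((Pi.single i 1, 0) : (Fin 4 → ℚ) × V) := by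
      ext i
      · simp [Prod.fst_sum, Finset.sum_apply, Pi.single_apply]
      · simp [Prod.snd_sum]
    rw [e1, map_sum]
    simp only [map_smul, Pi.add_apply, Finset.sum_apply, Pi.smul_apply, smul_eq_mul, Matrix.col_apply,
      Matrix.map_apply, Matrix.add_apply, Matrix.of_apply, eq_intCast, Int.cast_add, Int.cast_sum]
    congr 1
    · simp [Matrix.one_apply, Pi.single_apply]
    · apply Finset.sum_congr rfl
      intro i _
      rw [mulVec, dotProduct, Finset.sum_mul]
      apply Finset.sum_congr rfl
      intro j _
      have e2 : (rhoQ a - 1) i j = (N : ℚ) * (b i j : ℚ) := by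
        have := congrArg (Int.cast : ℤ → ℚ) (hb i j)
        rw [Matrix.sub_apply] at this ⊢
        rw [rhoQ_apply, Matrix.one_apply]
        rw [Matrix.one_apply] at this
        push_cast at this
        exact this
      rw [e2]
      push_cast
      rw [← ht r c i j]
      simp only [κ, ← hz]
      ring
  intro z
  have := LinearMap.congr_fun hlin (Ψ z)
  simpa using this

noncomputable def jj (Ψ : ((Fin 4 → ℚ) × V) ≃ₗ[ℚ] (Fin k → ℚ)) (F : Matrix (Fin k) (Fin k) ℚ) :
    OZ F →* (((Fin 4 → ℚ) × V) ≃ₗ[ℚ] ((Fin 4 → ℚ) × V)) where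
  toFun M :=
    { toFun := fun z => Ψ.symm (((M : GL (Fin k) ℤ) : Matrix (Fin k) (Fin k) ℤ).map (algebraMap ℤ ℚ) *ᵥ Ψ z)
      invFun := fun z => Ψ.symm ((((M : GL (Fin k) ℤ)⁻¹ : GL (Fin k) ℤ) : Matrix (Fin k) (Fin k) ℤ).map (algebraMap ℤ ℚ) *ᵥ Ψ z)
      map_add' := fun x y => by simp [mulVec_add]
      map_smul' := fun c x => by simp [mulVec_smul]
      left_inv := fun z => by
        simp only [LinearEquiv.apply_symm_apply, mulVec_mulVec, ← Matrix.map_mul, Units.inv_mul]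
        simp
      right_inv := fun z => by
        simp only [LinearEquiv.apply_symm_apply, mulVec_mulVec, ← Matrix.map_mul, Units.mul_inv]
        simp }
  map_one' := by
    apply LinearEquiv.ext
    intro z
    simp
  map_mul' a b := by
    apply LinearEquiv.ext
    intro z
    show Ψ.symm _ = Ψ.symm (_ *ᵥ Ψ (Ψ.symm _))
    rw [LinearEquiv.apply_symm_apply, mulVec_mulVec, ← Matrix.map_mul]
    rfl

theorem jj_apply (Ψ : ((Fin 4 → ℚ) × V) ≃ₗ[ℚ] (Fin k → ℚ)) (F : Matrix (Fin k) (Fin k) ℚ) (M : OZ F) (z) :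
    Ψ (jj Ψ F M z) = ((M : GL (Fin k) ℤ) : Matrix (Fin k) (Fin k) ℤ).map (algebraMap ℤ ℚ) *ᵥ Ψ z :=
  Ψ.apply_symm_apply _

theorem mat_ext_Q {A A' : Matrix (Fin k) (Fin k) ℤ}
    (h : ∀ v, A.map (algebraMap ℤ ℚ) *ᵥ v = A'.map (algebraMap ℤ ℚ) *ᵥ v) : A = A' := by
  have : A.map (algebraMap ℤ ℚ) = A'.map (algebraMap ℤ ℚ) :=
    Matrix.ext_of_mulVec_single fun i => h _
  exact Matrix.map_injective (RingHom.injective_int (algebraMap ℤ ℚ)) this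

theorem jj_inj (Ψ : ((Fin 4 → ℚ) × V) ≃ₗ[ℚ] (Fin k → ℚ)) (F : Matrix (Fin k) (Fin k) ℚ) :
    Function.Injective (jj Ψ F) := by
  intro M M' h
  apply Subtype.ext
  apply Units.ext
  apply mat_ext_Q
  intro v
  have h1 := jj_apply Ψ F M (Ψ.symm v)
  have h2 := jj_apply Ψ F M' (Ψ.symm v)
  rw [LinearEquiv.apply_symm_apply] at h1 h2
  rw [← h1, ← h2, h]

theorem jj_range (Ψ : ((Fin 4 → ℚ) × V) ≃ₗ[ℚ] (Fin k → ℚ)) (F : Matrix (Fin k) (Fin k) ℚ)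
    (g : ((Fin 4 → ℚ) × V) ≃ₗ[ℚ] ((Fin 4 → ℚ) × V)) (A A' : Matrix (Fin k) (Fin k) ℤ)
    (hA : ∀ z, Ψ (g z) = A.map (algebraMap ℤ ℚ) *ᵥ Ψ z)
    (hA' : ∀ z, Ψ (g⁻¹ z) = A'.map (algebraMap ℤ ℚ) *ᵥ Ψ z)
    (hQ : ∀ z, qeval F (Ψ (g z)) = qeval F (Ψ z)) : g ∈ (jj Ψ F).range := by
  have h1 : A * A' = 1 := by
    apply mat_ext_Q
    intro v
    rw [Matrix.map_mul, ← mulVec_mulVec, ← Ψ.apply_symm_apply v, ← hA', ← hA]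
    have : g (g⁻¹ (Ψ.symm v)) = Ψ.symm v := g.apply_symm_apply _
    rw [this]; simp
  have h2 : A' * A = 1 := by
    apply mat_ext_Q
    intro v
    rw [Matrix.map_mul, ← mulVec_mulVec, ← Ψ.apply_symm_apply v, ← hA, ← hA']
    have : g⁻¹ (g (Ψ.symm v)) = Ψ.symm v := g.symm_apply_apply _
    rw [this]; simp
  refine ⟨⟨⟨A, A', h1, h2⟩, ?_⟩, ?_⟩
  · intro v
    show qeval F (A.map (algebraMap ℤ ℚ) *ᵥ v) = _
    rw [← Ψ.apply_symm_apply v, ← hA, hQ]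
  · apply LinearEquiv.ext
    intro z
    apply Ψ.injective
    rw [jj_apply, hA]

end fin2

/-- Theorem A. For every `n ≥ 4` and every rational quadratic form `f`
of signature `(n,1)` in `n+1` variables which represents `q₃ = -x₀² + x₁² + x₂² + x₃²`,
the group `O(f, ℤ)` is noncoherent: it contains a finitely generated subgroup which is
not finitely presented. -/
theorem noncoherent_of_represents_q3 (n : ℕ) (hn : 4 ≤ n)
    (F : Matrix (Fin (n + 1)) (Fin (n + 1)) ℚ) (hFsymm : F.IsSymm)
    (hsig : HasSignature F n 1) (hrep : Represents F q3) :
    ∃ H : Subgroup ↥(OZ F), Group.FG ↥H ∧ ¬ IsFinitelyPresented ↥H := by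
  obtain ⟨m, hm, Hm, T, hT, hF⟩ := hrep
  set Ψ := Psi hm T hT with hΨ
  set B := BH Hm with hB
  have hFQ : ∀ z, qeval F (Ψ z) = QB B z := by
    intro z
    rw [hΨ, Psi_apply, hF, qeval_q3, QB, hB, BH_self]
  have hpos : ∀ y, y ≠ 0 → 0 < B y y := by
    intro y hy
    have h1 := posdef F hsig (Ψ (cq oo, 0)) (Ψ (0, y)) (by
      rw [hFQ]; simp [QB, IP, cq, oo]) (by
      rw [← map_add, hFQ, hFQ, hFQ]; simp [QB, IP]) (by
      intro h
      have := Ψ.map_eq_zero_iff.1 h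
      exact hy (congrArg Prod.snd this))
    rw [hFQ] at h1
    simpa [QB, IP] using h1
  have hm1 : 0 < m := by omega
  obtain ⟨y0, hy0⟩ : ∃ y0 : Fin m → ℚ, y0 ≠ 0 :=
    ⟨fun _ => 1, fun h => one_ne_zero (congrFun h ⟨0, hm1⟩)⟩
  have h0 := hpos y0 hy0
  have hs : ∀ x y, B x y = B y x := BH_symm Hm
  obtain ⟨K, hK⟩ := geom_main B hs (fun y => by
    by_cases hy : y = 0
    · rw [hy]; simp
    · exact (hpos y hy).le) y0 h0
  obtain ⟨N0, hN0, hI0⟩ := integral Ψ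
  obtain ⟨N1, hN1, hI1⟩ := integral ((tau B y0 h0).trans Ψ)
  set N := N0 * N1 * (K + 1) with hN
  have hNN : N ≠ 0 := by positivity
  obtain ⟨H, hH1, hH2, hH3⟩ := hK N hNN (by
    have : 1 ≤ N0 * N1 := Nat.one_le_iff_ne_zero.2 (by positivity)
    nlinarith)
  have hle : H ≤ (jj Ψ F).range := by
    apply hH3
    intro a ha
    have ha' := (Gam N).inv_mem ha
    constructor
    · obtain ⟨A, hA⟩ := hI0 N ⟨N1 * (K + 1), by rw [hN]; ring⟩ a ha
      obtain ⟨A', hA'⟩ := hI0 N ⟨N1 * (K + 1), by rw [hN]; ring⟩ _ ha'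
      refine jj_range Ψ F _ A A' hA (fun z => ?_) (fun z => ?_)
      · rw [← map_inv]; exact hA' z
      · rw [hFQ, hFQ, actV_Q]
    · obtain ⟨A, hA⟩ := hI1 N ⟨N0 * (K + 1), by rw [hN]; ring⟩ a ha
      obtain ⟨A', hA'⟩ := hI1 N ⟨N0 * (K + 1), by rw [hN]; ring⟩ _ ha'
      have hττ : ∀ z, tau B y0 h0 ((tau B y0 h0)⁻¹ z) = z := fun z => tau_inv B y0 h0 z
      refine jj_range Ψ F _ A A' (fun z => ?_) (fun z => ?_) (fun z => ?_)
      · have := hA ((tau B y0 h0)⁻¹ z)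
        simp only [LinearEquiv.trans_apply, hττ] at this
        exact this
      · have := hA' ((tau B y0 h0)⁻¹ z)
        simp only [LinearEquiv.trans_apply, hττ] at this
        rw [← this, _root_.mul_inv_rev, _root_.mul_inv_rev, inv_inv, ← map_inv, ← mul_assoc]
        rfl
      · rw [hFQ, hFQ]
        show QB B (tauF B y0 (actV _ a (tauF B y0 z))) = _
        rw [tau_Q B hs y0 h0, actV_Q, tau_Q B hs y0 h0]
  have hmap : (H.comap (jj Ψ F)).map (jj Ψ F) = H := by
    rw [Subgroup.map_comap_eq, inf_eq_right.2 hle]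
  have e : H.comap (jj Ψ F) ≃* H :=
    ((H.comap (jj Ψ F)).equivMapOfInjective (jj Ψ F) (jj_inj Ψ F)).trans (MulEquiv.subgroupCongr hmap)
  refine ⟨H.comap (jj Ψ F), ?_, fun h => hH2 (fp_equiv e h)⟩
  exact Group.fg_of_surjective (f := e.symm.toMonoidHom) e.symm.surjective

end Paper
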